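/- arXiv:math/0407385 — 12 statements merged into one kernel-verified Lean document; each statement's English description precedes it below -/
import Mathlib

section
/- For every integer N ≥ 2 there exist a locally finite connected simple graph G and a function φ from the vertices of G to ℂ such that for every vertex x and every integer p with 1 ≤ p ≤ N one has Σ_{y ∈ N(x)} (φ(y) − φ(x))^p = 0, while there exists a vertex x₀ with Σ_{y ∈ N(x₀)} (φ(y) − φ(x₀))^{N+1} ≠ 0. -/
open scoped BigOperators

/-- The graph on two copies of `ℂ` in which `(x, false)` and `(y, true)` are adjacent exactly when
`y - x` is an `n`-th root of unity. -/
def rootGraph (n : ℕ) : SimpleGraph (ℂ × Bool) where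
  Adj u v := u.2 ≠ v.2 ∧ ((v.1 - u.1) * (if u.2 then -1 else 1)) ^ n = 1
  symm := ⟨by
    rintro ⟨x, b⟩ ⟨y, c⟩ ⟨h, h'⟩
    refine ⟨h.symm, ?_⟩
    cases b <;> cases c <;> simp_all⟩
  loopless := ⟨fun _ h => h.1 rfl⟩

lemma rootGraph_neighborSet {n : ℕ} [NeZero n] {ζ : ℂ} (hζ : IsPrimitiveRoot ζ n) (u : ℂ × Bool) :
    (rootGraph n).neighborSet u =
      (fun j : ℕ => (u.1 + (if u.2 then -1 else 1) * ζ ^ j, !u.2)) ''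
        (Finset.range n : Set ℕ) := by
  obtain ⟨x, b⟩ := u
  ext ⟨y, c⟩
  simp only [SimpleGraph.mem_neighborSet, rootGraph, Set.mem_image, Finset.coe_range, Set.mem_Iio,
    Prod.mk.injEq]
  constructor
  · rintro ⟨h, h'⟩
    obtain ⟨j, hj, hj'⟩ := hζ.eq_pow_of_pow_eq_one h'
    refine ⟨j, hj, ?_, ?_⟩
    · rw [hj']
      cases b <;> simp
    · cases b <;> cases c <;> simp_all
  · rintro ⟨j, -, rfl, rfl⟩
    have hp : (ζ ^ j) ^ n = 1 := by rw [← pow_mul, mul_comm, pow_mul, hζ.pow_eq_one, one_pow]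
    cases b <;> simp [hp]

lemma rootGraph_finsum_pow {n : ℕ} [NeZero n] {ζ : ℂ} (hζ : IsPrimitiveRoot ζ n) (u : ℂ × Bool)
    (p : ℕ) :
    (∑ᶠ v ∈ (rootGraph n).neighborSet u, (v.1 - u.1) ^ p) =
      (if u.2 then -1 else 1) ^ p * ∑ j ∈ Finset.range n, (ζ ^ p) ^ j := by
  rw [rootGraph_neighborSet hζ, finsum_mem_image, finsum_mem_coe_finset, Finset.mul_sum]
  · refine Finset.sum_congr rfl fun j _ => ?_
    rw [add_sub_cancel_left, mul_pow, pow_right_comm]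
  · intro i hi j hj h
    simp only [Finset.coe_range, Set.mem_Iio] at hi hj
    refine hζ.pow_inj hi hj ?_
    have h' := (Prod.mk.inj h).1
    cases hu : u.2 <;> simpa [hu] using h'

lemma IsPrimitiveRoot.sum_range_pow_pow_eq_zero {n p : ℕ} {ζ : ℂ} (hζ : IsPrimitiveRoot ζ n)
    (hp : p ≠ 0) (hpn : p < n) : ∑ j ∈ Finset.range n, (ζ ^ p) ^ j = 0 := by
  have h := mul_geom_sum (ζ ^ p) n
  rw [pow_right_comm, hζ.pow_eq_one, one_pow, sub_self] at h
  exact (mul_eq_zero.1 h).resolve_left (sub_ne_zero.2 (hζ.pow_ne_one_of_pos_of_lt hp hpn))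

lemma SimpleGraph.ConnectedComponent.image_val_neighborSet {V : Type*} {G : SimpleGraph V}
    (C : G.ConnectedComponent) (x : C) :
    Subtype.val '' C.toSimpleGraph.neighborSet x = G.neighborSet x.1 := by
  ext v
  constructor
  · rintro ⟨y, hy, rfl⟩
    exact hy
  · intro hv
    exact ⟨⟨v, C.mem_supp_of_adj_mem_supp x.2 hv⟩, hv, rfl⟩

theorem stmt3 (N : ℕ) (hN : 2 ≤ N) :
    ∃ (V : Type) (G : SimpleGraph V) (φ : V → ℂ),
      G.Connected ∧ (∀ x : V, (G.neighborSet x).Finite) ∧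
      (∀ x : V, ∀ p : ℕ, 1 ≤ p → p ≤ N →
        (∑ᶠ y ∈ G.neighborSet x, (φ y - φ x) ^ p) = 0) ∧
      (∃ x₀ : V, (∑ᶠ y ∈ G.neighborSet x₀, (φ y - φ x₀) ^ (N + 1)) ≠ 0) := by
  have hζ := Complex.isPrimitiveRoot_exp (N + 1) N.succ_ne_zero
  set ζ := Complex.exp (2 * Real.pi * Complex.I / (N + 1 : ℕ))
  let C := (rootGraph (N + 1)).connectedComponentMk (0, false)
  have key (x : C) (p : ℕ) :
      (∑ᶠ y ∈ C.toSimpleGraph.neighborSet x, (y.1.1 - x.1.1) ^ p) =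
        (if x.1.2 then -1 else 1) ^ p * ∑ j ∈ Finset.range (N + 1), (ζ ^ p) ^ j := by
    rw [← rootGraph_finsum_pow hζ, ← C.image_val_neighborSet,
      finsum_mem_image Subtype.val_injective.injOn]
  refine ⟨C, C.toSimpleGraph, fun x => x.1.1, C.connected_toSimpleGraph, fun x => ?_,
    fun x p hp hpN => ?_, ⟨(0, false), rfl⟩, ?_⟩
  · refine Set.Finite.of_finite_image ?_ Subtype.val_injective.injOn
    rw [C.image_val_neighborSet, rootGraph_neighborSet hζ]
    exact (Finset.finite_toSet _).image _
  · rw [key, hζ.sum_range_pow_pow_eq_zero (by omega) (by omega), mul_zero]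
  · rw [key, hζ.pow_eq_one]
    simpa using N.cast_add_one_ne_zero (R := ℂ)
end

section
/- Let m ≥ 1 be an integer and let G be a connected locally finite simple graph with at least two vertices in which every vertex has degree at most m. If φ is a function from the vertices of G to ℂ such that for every vertex x and every integer p with 1 ≤ p ≤ m one has Σ_{y ∈ N(x)} (φ(y) − φ(x))^p = 0, then φ is constant. -/
open scoped BigOperators

open Polynomial in
/-- If the first `m` power sums of a family of at most `m` elements of a field of characteristic
zero vanish, then every member of the family is zero. -/
theorem eq_zero_of_sum_pow_eq_zero {ι K : Type*} [Field K] [CharZero K] (s : Finset ι)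
    (v : ι → K) (m : ℕ) (hs : s.card ≤ m)
    (h : ∀ p : ℕ, 1 ≤ p → p ≤ m → ∑ i ∈ s, v i ^ p = 0) {j : ι} (hj : j ∈ s) : v j = 0 := by
  classical
  by_contra hne
  set T := (s.image v).erase (v j) with hT
  set P : K[X] := X * ∏ b ∈ T.erase 0, (X - C b) with hP
  have hdeg : P.natDegree < m + 1 := by
    have hcard : T.card + 1 = (s.image v).card :=
      Finset.card_erase_add_one (Finset.mem_image_of_mem v hj)
    have him : (s.image v).card ≤ s.card := Finset.card_image_le
    have herase : (T.erase 0).card ≤ T.card := Finset.card_erase_le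
    have hmul : P.natDegree ≤ _ := natDegree_mul_le
    rw [natDegree_X, natDegree_finsetProd_X_sub_C_eq_card] at hmul
    omega
  have hzero : ∑ i ∈ s, P.eval (v i) = 0 := by
    simp_rw [eval_eq_sum_range' hdeg]
    rw [Finset.sum_comm]
    refine Finset.sum_eq_zero fun p hp => ?_
    rw [← Finset.mul_sum]
    rcases Nat.eq_zero_or_pos p with rfl | hpos
    · simp [hP]
    · rw [h p hpos (Nat.lt_succ_iff.mp (Finset.mem_range.mp hp)), mul_zero]
  have heval : ∀ i ∈ s, P.eval (v i) = if v i = v j then P.eval (v j) else 0 := by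
    intro i hi
    split_ifs with hij
    · rw [hij]
    · by_cases h0 : v i = 0
      · simp [hP, h0]
      · have hmem : v i ∈ T.erase 0 := by simp [hT, h0, hij]; exact ⟨i, hi, rfl⟩
        rw [hP, eval_mul, eval_prod, Finset.prod_eq_zero hmem (by simp), mul_zero]
  rw [Finset.sum_congr rfl heval, ← Finset.sum_filter, Finset.sum_const, nsmul_eq_mul,
    mul_eq_zero, Nat.cast_eq_zero, Finset.card_eq_zero] at hzero
  rcases hzero with hempty | hroot
  · exact Finset.notMem_empty j (hempty ▸ Finset.mem_filter.mpr ⟨hj, rfl⟩)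
  · rw [hP, eval_mul, eval_X, eval_prod, mul_eq_zero, Finset.prod_eq_zero_iff] at hroot
    rcases hroot with h0 | ⟨b, hb, hb0⟩
    · exact hne h0
    · rw [eval_sub, eval_X, eval_C, sub_eq_zero] at hb0
      simp [hT, hb0] at hb

theorem stmt4 (m : ℕ) (hm : 1 ≤ m) {V : Type*} (G : SimpleGraph V)
    (hconn : G.Connected) (hnt : Nontrivial V)
    (hfin : ∀ x : V, (G.neighborSet x).Finite)
    (hdeg : ∀ x : V, (G.neighborSet x).ncard ≤ m)
    (φ : V → ℂ)
    (h : ∀ x : V, ∀ p : ℕ, 1 ≤ p → p ≤ m →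
      (∑ᶠ y ∈ G.neighborSet x, (φ y - φ x) ^ p) = 0) :
    ∀ x y : V, φ x = φ y := by
  have hadj : ∀ x y : V, G.Adj x y → φ x = φ y := by
    intro x y hxy
    have hsum : ∀ p : ℕ, 1 ≤ p → p ≤ m →
        ∑ z ∈ (hfin x).toFinset, (φ z - φ x) ^ p = 0 := by
      intro p hp hpm
      rw [← finsum_mem_eq_finite_toFinset_sum _ (hfin x)]
      exact h x p hp hpm
    have hcard : (hfin x).toFinset.card ≤ m := by
      rw [← Set.ncard_eq_toFinset_card _ (hfin x)]
      exact hdeg x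
    have hy : y ∈ (hfin x).toFinset := (hfin x).mem_toFinset.mpr hxy
    exact (sub_eq_zero.mp
      (eq_zero_of_sum_pow_eq_zero _ (fun z => φ z - φ x) m hcard hsum hy)).symm
  intro x y
  obtain ⟨w⟩ := hconn.preconnected x y
  induction w with
  | nil => rfl
  | cons hxy _ ih => exact (hadj _ _ hxy).trans ih
end

section
/- Let G be a nonempty connected acyclic simple graph in which every vertex has degree 3 (a 3-regular tree). Then there exists a non-constant function φ from the vertices of G to ℂ such that both φ and φ² are harmonic, i.e. for every vertex x, Σ_{y ∈ N(x)} (φ(y) − φ(x)) = 0 and Σ_{y ∈ N(x)} (φ(y) − φ(x))² = 0. -/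
open scoped BigOperators

/-- Recursion along a parent map that decreases a rank away from the root. -/
theorem exists_rec_of_rank_lt {V α : Type*} (d : V → ℕ) (p : V → V) (r : V)
    (hp : ∀ v, v ≠ r → d (p v) < d v) (a : α) (F : V → α → α) :
    ∃ s : V → α, s r = a ∧ ∀ v, v ≠ r → s v = F v (s (p v)) := by
  classical
  let wf : WellFounded (fun u v : V ↦ d u < d v) := InvImage.wf d Nat.lt_wfRel.wf
  refine ⟨wf.fix fun v ih ↦ if h : v = r then a else F v (ih (p v) (hp v h)), ?_, fun v hv ↦ ?_⟩
  · rw [wf.fix_eq, dif_pos rfl]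
  · rw [wf.fix_eq, dif_neg hv]

theorem finsum_mem_triple {V M : Type*} [AddCommMonoid M] {x y z : V} (hxy : x ≠ y) (hxz : x ≠ z)
    (hyz : y ≠ z) (g : V → M) : ∑ᶠ v ∈ ({x, y, z} : Set V), g v = g x + (g y + g z) := by
  rw [finsum_mem_insert g (by simp [hxy, hxz]) (Set.toFinite _), finsum_mem_pair hyz]

/-- Complex weights on a three-element set with vanishing sum and vanishing sum of squares,
normalized to be `1` at a prescribed element. -/
theorem exists_isotropic_weight {V : Type*} {s : Set V} (hs : s.ncard = 3) (b : V) :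
    ∃ w : V → ℂ, (∑ᶠ y ∈ s, w y) = 0 ∧ (∑ᶠ y ∈ s, w y ^ 2) = 0 ∧
      (∀ y, w y ≠ 0) ∧ (b ∈ s → w b = 1) := by
  classical
  obtain ⟨x, y, z, hxy, hxz, hyz, rfl⟩ := Set.ncard_eq_three.mp hs
  obtain ⟨ω, hω⟩ : ∃ ω : ℂ, 1 + ω + ω ^ 2 = 0 := by
    have h := Complex.isPrimitiveRoot_exp 3 (by norm_num)
    exact ⟨_, by simpa only [Finset.sum_range_succ, Finset.sum_range_zero, zero_add, pow_zero,
      pow_one] using h.geom_sum_eq_zero (by norm_num)⟩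
  have hω0 : ω ≠ 0 := by
    rintro rfl
    norm_num at hω
  let u : V → ℂ := fun v ↦ if v = y then ω else if v = z then ω ^ 2 else 1
  have hu : ∀ v, u v ≠ 0 := fun v ↦ by
    simp only [u]
    split_ifs <;> simp [hω0]
  have hux : u x = 1 := by simp [u, hxy, hxz]
  have huy : u y = ω := by simp [u]
  have huz : u z = ω ^ 2 := by simp [u, hyz.symm]
  refine ⟨fun v ↦ u v / u b, ?_, ?_, fun v ↦ div_ne_zero (hu v) (hu b), fun _ ↦ div_self (hu b)⟩
  · rw [finsum_mem_triple hxy hxz hyz, hux, huy, huz]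
    linear_combination hω / u b
  · simp only [finsum_mem_triple hxy hxz hyz, hux, huy, huz]
    linear_combination (1 - ω + ω ^ 2) * hω / u b ^ 2

/-- A rooted tree has a parent map: it decreases the distance to the root, and across every edge
one endpoint is a non-root vertex whose parent is the other endpoint. -/
theorem SimpleGraph.IsTree.exists_parent {V : Type*} {G : SimpleGraph V} (hG : G.IsTree) (r : V) :
    ∃ p : V → V, (∀ v, v ≠ r → G.dist r (p v) < G.dist r v) ∧
      ∀ x y, G.Adj x y → (y ≠ r ∧ p y = x) ∨ (x ≠ r ∧ p x = y) := by
  choose f hf using fun v ↦ hG.connected.exists_walk_length_eq_dist v r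
  have key : ∀ x y, G.Adj x y → G.dist r y = G.dist r x + 1 → y ≠ r ∧ (f y).snd = x := by
    intro x y hxy hd
    refine ⟨?_, ?_⟩
    · rintro rfl
      simp at hd
    · have hlen : (SimpleGraph.Walk.cons hxy.symm (f x)).length = G.dist y r := by
        rw [SimpleGraph.Walk.length_cons, hf x, SimpleGraph.dist_comm, ← hd,
          SimpleGraph.dist_comm]
      have h := congrArg Subtype.val ((hG.isAcyclic.subsingleton_path y r).elim
        ⟨f y, (f y).isPath_of_length_eq_dist (hf y)⟩
        ⟨_, SimpleGraph.Walk.isPath_of_length_eq_dist _ hlen⟩)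
      dsimp only at h
      rw [h, SimpleGraph.Walk.snd_cons]
  refine ⟨fun v ↦ (f v).snd, fun v hv ↦ ?_, fun x y hxy ↦ ?_⟩
  · have h₁ := SimpleGraph.dist_le (f v).tail
    have h₂ := SimpleGraph.Walk.length_tail_add_one
      (SimpleGraph.Walk.not_nil_of_ne (p := f v) hv)
    rw [hf v] at h₂
    rw [SimpleGraph.dist_comm, SimpleGraph.dist_comm (u := r) (v := v)]
    dsimp only
    omega
  · rcases hG.dist_eq_dist_add_one_of_adj r hxy with h | h
    · exact Or.inr (key y x hxy.symm h)
    · exact Or.inl (key x y hxy h)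

theorem stmt5 {V : Type*} (G : SimpleGraph V)
    (hconn : G.Connected) (hac : G.IsAcyclic)
    (hdeg : ∀ v : V, (G.neighborSet v).ncard = 3) :
    ∃ φ : V → ℂ, (¬ ∀ x y : V, φ x = φ y) ∧
      (∀ x : V, (∑ᶠ y ∈ G.neighborSet x, (φ y - φ x)) = 0 ∧
                (∑ᶠ y ∈ G.neighborSet x, (φ y - φ x) ^ 2) = 0) := by
  obtain ⟨r⟩ := hconn.nonempty
  obtain ⟨p, hp, hadj⟩ := SimpleGraph.IsTree.exists_parent ⟨hconn, hac⟩ r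
  choose w hw₁ hw₂ hw₀ hwp using fun x ↦ exists_isotropic_weight (hdeg x) (p x)
  -- The state at `v` is the pair `(φ v, c v)` with `c v = φ v - φ (p v)` away from the root.
  obtain ⟨s, hsr, hs⟩ := exists_rec_of_rank_lt (G.dist r) p r hp ((0, 1) : ℂ × ℂ)
    fun v t ↦ (t.1 - t.2 * w (p v) v, -(t.2 * w (p v) v))
  have hdiff : ∀ x y, y ∈ G.neighborSet x → (s y).1 - (s x).1 = -(s x).2 * w x y := by
    intro x y hxy
    rcases hadj x y hxy with ⟨hy, rfl⟩ | ⟨hx, rfl⟩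
    · rw [hs y hy]
      ring
    · rw [hwp x hxy, hs x hx]
      ring
  refine ⟨fun v ↦ (s v).1, fun hconst ↦ ?_, fun x ↦ ⟨?_, ?_⟩⟩
  · obtain ⟨y, hy⟩ := Set.nonempty_of_ncard_ne_zero (by rw [hdeg r]; norm_num :
      (G.neighborSet r).ncard ≠ 0)
    have h := hdiff r y hy
    rw [show (s y).1 = (s r).1 from hconst y r, hsr] at h
    exact hw₀ r y (by simpa using h)
  · rw [finsum_mem_congr rfl (hdiff x), ← mul_finsum_mem, hw₁, mul_zero]
  · rw [finsum_mem_congr rfl fun y hy ↦ by rw [hdiff x y hy, mul_pow],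
      ← mul_finsum_mem, hw₂, mul_zero]
end

section
/- Let G be a 3-regular tree and φ a non-constant holomorphic function from the vertices of G to ℂ. Then for every vertex v with (three distinct) neighbors y₁, y₂, y₃ there exists δ ∈ ℂ with δ ≠ 0 such that the set {φ(y₁) − φ(v), φ(y₂) − φ(v), φ(y₃) − φ(v)} equals {δ, jδ, j²δ}, where j = exp(2πi/3). In particular, φ is injective on the closed ball of radius 1 around v, i.e. on {v} ∪ N(v). -/
open scoped BigOperators

/-- If `a + b + c` and `a ^ 2 + b ^ 2 + c ^ 2` vanish and `a = 0`, then `b = c = 0`. -/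
lemma eq_zero_of_sum_sq_eq_zero {a b c : ℂ} (h₁ : a + b + c = 0)
    (h₂ : a ^ 2 + b ^ 2 + c ^ 2 = 0) (ha : a = 0) : b = 0 ∧ c = 0 := by
  have hb : b = 0 := by
    have hbb : b ^ 2 = 0 := by linear_combination h₂ / 2 - a * ha / 2 + (b - c) * (h₁ - ha) / 2
    simpa using hbb
  exact ⟨hb, by linear_combination h₁ - ha - hb⟩

/-- If `a + b + c` and `a ^ 2 + b ^ 2 + c ^ 2` vanish and `a = b`, then `a = 0`. -/
lemma eq_zero_of_sum_sq_eq_zero_of_eq {a b c : ℂ} (h₁ : a + b + c = 0)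
    (h₂ : a ^ 2 + b ^ 2 + c ^ 2 = 0) (hab : a = b) : a = 0 := by
  subst hab
  have haa : a ^ 2 = 0 := by linear_combination h₂ / 6 - (c - 2 * a) * h₁ / 6
  simpa using haa

lemma exp_two_pi_div_three_quadratic :
    Complex.exp (2 * Real.pi * Complex.I / 3) ^ 2 + Complex.exp (2 * Real.pi * Complex.I / 3) + 1
      = 0 := by
  have h := (Complex.isPrimitiveRoot_exp 3 (by norm_num)).geom_sum_eq_zero (by norm_num)
  simp only [Finset.sum_range_succ, Finset.sum_range_zero, Nat.cast_ofNat] at h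
  linear_combination h

/-- Three numbers with vanishing sum and vanishing sum of squares form, up to order, a multiple of
the cube roots of unity. -/
lemma insert_eq_of_sum_sq_eq_zero {a b c j : ℂ} (hj : j ^ 2 + j + 1 = 0)
    (h₁ : a + b + c = 0) (h₂ : a ^ 2 + b ^ 2 + c ^ 2 = 0) :
    ({a, b, c} : Set ℂ) = {a, j * a, j ^ 2 * a} := by
  have h : (b - j * a) * (b - j ^ 2 * a) = 0 := by
    linear_combination h₂ / 2 + (a + b - c) * h₁ / 2 + (a ^ 2 * (j - 1) - a * b) * hj
  rcases mul_eq_zero.mp h with h | h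
  · have hb : b = j * a := by linear_combination h
    have hc : c = j ^ 2 * a := by linear_combination h₁ - h - a * hj
    rw [hb, hc]
  · have hb : b = j ^ 2 * a := by linear_combination h
    have hc : c = j * a := by linear_combination h₁ - h - a * hj
    rw [hb, hc, Set.pair_comm]

namespace SimpleGraph

variable {V : Type*} {G : SimpleGraph V}

lemma neighborSet_eq_of_ncard_eq_three {v y₁ y₂ y₃ : V} (hdeg : (G.neighborSet v).ncard = 3)
    (h₁ : G.Adj v y₁) (h₂ : G.Adj v y₂) (h₃ : G.Adj v y₃)
    (h₁₂ : y₁ ≠ y₂) (h₁₃ : y₁ ≠ y₃) (h₂₃ : y₂ ≠ y₃) :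
    G.neighborSet v = {y₁, y₂, y₃} := by
  symm
  refine Set.eq_of_subset_of_ncard_le ?_ ?_ (Set.finite_of_ncard_ne_zero (by omega))
  · rintro x (rfl | rfl | rfl) <;> assumption
  · rw [hdeg, Set.ncard_eq_three.mpr ⟨y₁, y₂, y₃, h₁₂, h₁₃, h₂₃, rfl⟩]

lemma finsum_mem_neighborSet_eq_add {v y₁ y₂ y₃ : V} (hN : G.neighborSet v = {y₁, y₂, y₃})
    (h₁₂ : y₁ ≠ y₂) (h₁₃ : y₁ ≠ y₃) (h₂₃ : y₂ ≠ y₃) (f : V → ℂ) :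
    ∑ᶠ y ∈ G.neighborSet v, f y = f y₁ + f y₂ + f y₃ := by
  rw [hN, finsum_mem_insert _ (by simp [h₁₂, h₁₃]) (Set.toFinite _), finsum_mem_pair h₂₃,
    add_assoc]

/-- If a property of vertices passes to neighbors, then on a connected graph it holds everywhere
as soon as it holds somewhere. -/
lemma Connected.forall_of_adj (hconn : G.Connected) {P : V → Prop}
    (hP : ∀ v w, G.Adj v w → P v → P w) {v : V} (hv : P v) (w : V) : P w := by
  obtain ⟨p⟩ := hconn.preconnected v w
  induction p with
  | nil => exact hv
  | cons h _ ih => exact ih (hP _ _ h hv)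

/-- A holomorphic function on a cubic graph that agrees at `v` and one neighbor of `v` agrees at `v`
and all neighbors of `v`. -/
lemma eq_of_adj_of_holomorphic {φ : V → ℂ} {v u w : V} (hdeg : (G.neighborSet v).ncard = 3)
    (hhol : (∑ᶠ y ∈ G.neighborSet v, (φ y - φ v)) = 0 ∧
      (∑ᶠ y ∈ G.neighborSet v, (φ y - φ v) ^ 2) = 0)
    (hu : G.Adj v u) (huv : φ u = φ v) (hw : G.Adj v w) : φ w = φ v := by
  obtain ⟨x, y, z, hxy, hxz, hyz, hN⟩ := Set.ncard_eq_three.mp hdeg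
  rw [finsum_mem_neighborSet_eq_add hN hxy hxz hyz,
    finsum_mem_neighborSet_eq_add hN hxy hxz hyz] at hhol
  obtain ⟨h₁, h₂⟩ := hhol
  have hu' : u ∈ G.neighborSet v := hu
  have hw' : w ∈ G.neighborSet v := hw
  have key : φ x - φ v = 0 ∧ φ y - φ v = 0 ∧ φ z - φ v = 0 := by
    rw [hN] at hu'
    rcases hu' with rfl | rfl | rfl
    · exact ⟨sub_eq_zero.mpr huv, eq_zero_of_sum_sq_eq_zero h₁ h₂ (sub_eq_zero.mpr huv)⟩
    · obtain ⟨hx, hz⟩ := eq_zero_of_sum_sq_eq_zero (b := φ x - φ v) (c := φ z - φ v)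
        (by linear_combination h₁) (by linear_combination h₂) (sub_eq_zero.mpr huv)
      exact ⟨hx, sub_eq_zero.mpr huv, hz⟩
    · obtain ⟨hx, hy⟩ := eq_zero_of_sum_sq_eq_zero (b := φ x - φ v) (c := φ y - φ v)
        (by linear_combination h₁) (by linear_combination h₂) (sub_eq_zero.mpr huv)
      exact ⟨hx, hy, sub_eq_zero.mpr huv⟩
  obtain ⟨hx, hy, hz⟩ := key
  rw [hN] at hw'
  rcases hw' with rfl | rfl | rfl
  exacts [sub_eq_zero.mp hx, sub_eq_zero.mp hy, sub_eq_zero.mp hz]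

/-- A non-constant holomorphic function on a connected cubic graph separates adjacent vertices. -/
lemma Connected.ne_of_adj_of_holomorphic (hconn : G.Connected)
    (hdeg : ∀ v : V, (G.neighborSet v).ncard = 3) {φ : V → ℂ}
    (hnc : ¬ ∀ x y : V, φ x = φ y)
    (hhol : ∀ x : V, (∑ᶠ y ∈ G.neighborSet x, (φ y - φ x)) = 0 ∧
      (∑ᶠ y ∈ G.neighborSet x, (φ y - φ x) ^ 2) = 0)
    {v u : V} (hu : G.Adj v u) : φ u ≠ φ v := by
  intro huv
  have hall := hconn.forall_of_adj (P := fun x ↦ φ x = φ v ∧ ∀ w, G.Adj x w → φ w = φ x)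
    (fun x y hxy ⟨hx, hx'⟩ ↦ ⟨(hx' y hxy).trans hx, fun w hw ↦
      eq_of_adj_of_holomorphic (hdeg y) (hhol y) hxy.symm (hx' y hxy).symm hw⟩)
    ⟨rfl, fun w hw ↦ eq_of_adj_of_holomorphic (hdeg v) (hhol v) hu huv hw⟩
  exact hnc fun x y ↦ (hall x).1.trans (hall y).1.symm

end SimpleGraph

theorem stmt6 {V : Type*} (G : SimpleGraph V)
    (hconn : G.Connected) (hac : G.IsAcyclic)
    (hdeg : ∀ v : V, (G.neighborSet v).ncard = 3)
    (φ : V → ℂ)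
    (hnc : ¬ ∀ x y : V, φ x = φ y)
    (hhol : ∀ x : V, (∑ᶠ y ∈ G.neighborSet x, (φ y - φ x)) = 0 ∧
                     (∑ᶠ y ∈ G.neighborSet x, (φ y - φ x) ^ 2) = 0) :
    ∀ v y₁ y₂ y₃ : V, G.Adj v y₁ → G.Adj v y₂ → G.Adj v y₃ →
      y₁ ≠ y₂ → y₁ ≠ y₃ → y₂ ≠ y₃ →
      (∃ δ : ℂ, δ ≠ 0 ∧
        ({φ y₁ - φ v, φ y₂ - φ v, φ y₃ - φ v} : Set ℂ) =
          {δ, Complex.exp (2 * Real.pi * Complex.I / 3) * δ,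
             (Complex.exp (2 * Real.pi * Complex.I / 3)) ^ 2 * δ}) ∧
      Set.InjOn φ (insert v (G.neighborSet v)) := by
  intro v y₁ y₂ y₃ hy₁ hy₂ hy₃ h₁₂ h₁₃ h₂₃
  have hN := SimpleGraph.neighborSet_eq_of_ncard_eq_three (hdeg v) hy₁ hy₂ hy₃ h₁₂ h₁₃ h₂₃
  obtain ⟨hs, hq⟩ := hhol v
  rw [SimpleGraph.finsum_mem_neighborSet_eq_add hN h₁₂ h₁₃ h₂₃] at hs hq
  have hne : ∀ {u : V}, G.Adj v u → φ u ≠ φ v :=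
    fun hu ↦ hconn.ne_of_adj_of_holomorphic hdeg hnc hhol hu
  refine ⟨⟨φ y₁ - φ v, sub_ne_zero.mpr (hne hy₁),
    insert_eq_of_sum_sq_eq_zero exp_two_pi_div_three_quadratic hs hq⟩, ?_⟩
  have n₁ := hne hy₁
  have n₂ := hne hy₂
  have n₃ := hne hy₃
  have n₁₂ : φ y₁ ≠ φ y₂ := fun h ↦ n₁ <| sub_eq_zero.mp <|
    eq_zero_of_sum_sq_eq_zero_of_eq hs hq (by rw [h])
  have n₁₃ : φ y₁ ≠ φ y₃ := fun h ↦ n₁ <| sub_eq_zero.mp <|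
    eq_zero_of_sum_sq_eq_zero_of_eq (b := φ y₃ - φ v) (c := φ y₂ - φ v)
      (by linear_combination hs) (by linear_combination hq) (by rw [h])
  have n₂₃ : φ y₂ ≠ φ y₃ := fun h ↦ n₂ <| sub_eq_zero.mp <|
    eq_zero_of_sum_sq_eq_zero_of_eq (b := φ y₃ - φ v) (c := φ y₁ - φ v)
      (by linear_combination hs) (by linear_combination hq) (by rw [h])
  rw [hN]
  rintro x (rfl | rfl | rfl | rfl) y (rfl | rfl | rfl | rfl) hxy <;> first | rfl | grind
end

section
/- Let G be a 3-regular tree, let v₀ and v₁ be adjacent vertices, and let φ be a holomorphic function from the vertices of G to ℂ with φ(v₀) = 0 and φ(v₁) = 1. Then the range of φ equals Λ ∪ (1 + Λ), where j = exp(2πi/3) and Λ = {m(1−j) + n(1−j²) : m, n ∈ ℤ}; that is, φ maps the vertices of G onto the vertex set of the hexagonal tiling of the plane. -/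
open scoped BigOperators

/-- `j = exp(2πi/3)`, a primitive cube root of unity. -/
noncomputable def jCube : ℂ := Complex.exp (2 * Real.pi * Complex.I / 3)

/-- The lattice `Λ = {m(1−j) + n(1−j²) : m, n ∈ ℤ}`. -/
def hexLattice : Set ℂ := {z | ∃ m n : ℤ, z = m * (1 - jCube) + n * (1 - jCube ^ 2)}

theorem jCube_sq_add : jCube ^ 2 + jCube + 1 = 0 := by
  have h := (Complex.isPrimitiveRoot_exp 3 (by norm_num)).geom_sum_eq_zero (by norm_num)
  have hj : Complex.exp (2 * Real.pi * Complex.I / ((3 : ℕ) : ℂ)) = jCube := by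
    rw [jCube]; norm_num
  rw [hj] at h
  simp only [Finset.sum_range_succ, Finset.sum_range_zero] at h
  linear_combination h

/-- Three complex numbers with vanishing sum and vanishing sum of squares form an orbit under
multiplication by the cube roots of unity. -/
theorem eq_jCube_mul_of_sum_eq_zero {a b c : ℂ} (h1 : a + b + c = 0)
    (h2 : a ^ 2 + b ^ 2 + c ^ 2 = 0) :
    (b = jCube * a ∧ c = jCube ^ 2 * a) ∨ (b = jCube ^ 2 * a ∧ c = jCube * a) := by
  have hj := jCube_sq_add
  have hc : c = -a - b := by linear_combination h1
  subst hc
  have h : (b - jCube * a) * (b - jCube ^ 2 * a) = 0 := by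
    linear_combination h2 / 2 + (a ^ 2 * (jCube - 1) - a * b) * hj
  rcases mul_eq_zero.mp h with h | h
  · exact Or.inl ⟨by linear_combination h, by linear_combination -h - a * hj⟩
  · exact Or.inr ⟨by linear_combination h, by linear_combination -h - a * hj⟩

/-- The increments of `φ` along the edges at `x` are exactly `d`, `jd` and `j²d`. -/
def HasIncrements {V : Type*} (G : SimpleGraph V) (φ : V → ℂ) (x : V) (d : ℂ) : Prop :=
  ∀ e : ℂ, (∃ y, G.Adj x y ∧ φ y = φ x + e) ↔ e = d ∨ e = jCube * d ∨ e = jCube ^ 2 * d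

theorem HasIncrements.mul_jCube {V : Type*} {G : SimpleGraph V} {φ : V → ℂ} {x : V} {d : ℂ}
    (h : HasIncrements G φ x (jCube * d)) : HasIncrements G φ x d := by
  have hj : jCube ^ 2 * (jCube * d) = d := by
    linear_combination (jCube - 1) * d * jCube_sq_add
  have hj' : jCube * (jCube * d) = jCube ^ 2 * d := by ring
  intro e
  rw [h e, hj, hj']
  tauto

theorem hasIncrements_of_adj {V : Type*} {G : SimpleGraph V} {φ : V → ℂ} {x y : V}
    (hdeg : (G.neighborSet x).ncard = 3)
    (hsum : ∑ᶠ y ∈ G.neighborSet x, (φ y - φ x) = 0)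
    (hsq : ∑ᶠ y ∈ G.neighborSet x, (φ y - φ x) ^ 2 = 0) (hxy : G.Adj x y) :
    HasIncrements G φ x (φ y - φ x) := by
  classical
  obtain ⟨s, hs⟩ : ∃ s : Finset V, (s : Set V) = G.neighborSet x :=
    ⟨(Set.finite_of_ncard_pos (hdeg ▸ three_pos)).toFinset, Set.Finite.coe_toFinset _⟩
  have hcard : s.card = 3 := by rw [← Set.ncard_coe_finset, hs, hdeg]
  have hmem : ∀ z, G.Adj x z ↔ z ∈ s := fun z => by
    rw [← Finset.mem_coe, hs, SimpleGraph.mem_neighborSet]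
  rw [← hs, finsum_mem_coe_finset] at hsum hsq
  have hys := (hmem y).1 hxy
  have he : (s.erase y).card = 2 := by rw [Finset.card_erase_of_mem hys, hcard]
  obtain ⟨b, c, hbc, hbc'⟩ := Finset.card_eq_two.1 he
  rw [← Finset.add_sum_erase _ _ hys, hbc', Finset.sum_pair hbc, ← add_assoc] at hsum hsq
  have hadj : ∀ z, G.Adj x z ↔ z = y ∨ z = b ∨ z = c := fun z => by
    rw [hmem, ← Finset.insert_erase hys, hbc']; simp
  have hiff : ∀ e : ℂ, (∃ z, G.Adj x z ∧ φ z = φ x + e) ↔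
      e = φ y - φ x ∨ e = φ b - φ x ∨ e = φ c - φ x := fun e => by
    simp only [hadj, or_and_right, exists_or, exists_eq_left, eq_sub_iff_add_eq',
      @eq_comm ℂ (φ x + e)]
  intro e
  rw [hiff e]
  rcases eq_jCube_mul_of_sum_eq_zero hsum hsq with ⟨h, h'⟩ | ⟨h, h'⟩
  · rw [h, h']
  · rw [h, h', or_comm (a := e = jCube ^ 2 * _)]

theorem hasIncrements_of_increment {V : Type*} {G : SimpleGraph V} {φ : V → ℂ} {x y : V} {d : ℂ}
    (h : HasIncrements G φ x (φ y - φ x))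
    (hd : φ y - φ x = d ∨ φ y - φ x = jCube * d ∨ φ y - φ x = jCube ^ 2 * d) :
    HasIncrements G φ x d := by
  rcases hd with hd | hd | hd <;> rw [hd] at h
  · exact h
  · exact h.mul_jCube
  · rw [pow_two, mul_assoc] at h
    exact h.mul_jCube.mul_jCube

theorem stmt7 {V : Type*} (G : SimpleGraph V)
    (hconn : G.Connected) (hac : G.IsAcyclic)
    (hdeg : ∀ v : V, (G.neighborSet v).ncard = 3)
    (v₀ v₁ : V) (hadj : G.Adj v₀ v₁)
    (φ : V → ℂ)
    (hhol : ∀ x : V, (∑ᶠ y ∈ G.neighborSet x, (φ y - φ x)) = 0 ∧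
                     (∑ᶠ y ∈ G.neighborSet x, (φ y - φ x) ^ 2) = 0)
    (h0 : φ v₀ = 0) (h1 : φ v₁ = 1) :
    Set.range φ = hexLattice ∪ {z : ℂ | ∃ w ∈ hexLattice, z = 1 + w} := by
  have hinc : ∀ {x y : V}, G.Adj x y → HasIncrements G φ x (φ y - φ x) := fun {x y} h =>
    hasIncrements_of_adj (hdeg x) (hhol x).1 (hhol x).2 h
  have hback : ∀ {x y : V} {d : ℂ}, HasIncrements G φ x d → G.Adj x y →
      HasIncrements G φ y (-d) := by
    intro x y d hx hxy
    have hd := (hx (φ y - φ x)).1 ⟨y, hxy, by ring⟩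
    refine hasIncrements_of_increment (hinc hxy.symm) ?_
    rcases hd with hd | hd | hd
    · left; linear_combination -hd
    · right; left; linear_combination -hd
    · right; right; linear_combination -hd
  have hv₀ : HasIncrements G φ v₀ 1 := by
    have h := hinc hadj
    rwa [h0, h1, sub_zero] at h
  have hcoset : ∀ x, (φ x ∈ hexLattice ∧ HasIncrements G φ x 1) ∨
      (φ x - 1 ∈ hexLattice ∧ HasIncrements G φ x (-1)) := by
    have hone : ∀ {z d : ℂ}, (d = 1 ∨ d = jCube * 1 ∨ d = jCube ^ 2 * 1) →
        (z ∈ hexLattice → z + d - 1 ∈ hexLattice) ∧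
          (z - 1 ∈ hexLattice → z - d ∈ hexLattice) := by
      intro z d hd
      refine ⟨fun ⟨m, n, h⟩ => ?_, fun ⟨m, n, h⟩ => ?_⟩
      · rcases hd with rfl | rfl | rfl
        · exact ⟨m, n, by linear_combination h⟩
        · exact ⟨m - 1, n, by push_cast; linear_combination h⟩
        · exact ⟨m, n - 1, by push_cast; linear_combination h⟩
      · rcases hd with rfl | rfl | rfl
        · exact ⟨m, n, by linear_combination h⟩
        · exact ⟨m + 1, n, by push_cast; linear_combination h⟩
        · exact ⟨m, n + 1, by push_cast; linear_combination h⟩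
    intro x
    have hreach := (SimpleGraph.reachable_iff_reflTransGen v₀ x).1 (hconn.preconnected v₀ x)
    induction hreach with
    | refl => exact Or.inl ⟨⟨0, 0, by simp [h0]⟩, hv₀⟩
    | @tail y z _ hyz ih =>
      rcases ih with ⟨hy, hy'⟩ | ⟨hy, hy'⟩
      · right
        refine ⟨?_, hback hy' hyz⟩
        have h := (hone ((hy' (φ z - φ y)).1 ⟨z, hyz, by ring⟩)).1 hy
        rwa [add_sub_cancel] at h
      · left
        refine ⟨?_, by simpa using hback hy' hyz⟩
        have hd := (hy' (φ z - φ y)).1 ⟨z, hyz, by ring⟩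
        have h := (hone (d := φ y - φ z) (by
          rcases hd with hd | hd | hd
          · left; linear_combination -hd
          · right; left; linear_combination -hd
          · right; right; linear_combination -hd)).2 hy
        rwa [sub_sub_cancel] at h
  have hstep : ∀ {x : V} {d e : ℂ}, HasIncrements G φ x 1 →
      (d = 1 ∨ d = jCube ∨ d = jCube ^ 2) → (e = 1 ∨ e = jCube ∨ e = jCube ^ 2) →
      ∃ y, HasIncrements G φ y 1 ∧ φ y = φ x + (d - e) := by
    intro x d e hx hd he
    obtain ⟨y, hxy, hy⟩ := (hx d).2 (by simpa using hd)
    have hy' := hback hx hxy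
    obtain ⟨z, hyz, hz⟩ := (hy' (-e)).2 (by simpa using he)
    refine ⟨z, by simpa using hback hy' hyz, ?_⟩
    rw [hz, hy]; ring
  have hline : ∀ {d e : ℂ}, (d = 1 ∨ d = jCube ∨ d = jCube ^ 2) →
      (e = 1 ∨ e = jCube ∨ e = jCube ^ 2) → ∀ (m : ℤ) {x : V}, HasIncrements G φ x 1 →
      ∃ y, HasIncrements G φ y 1 ∧ φ y = φ x + m * (d - e) := by
    intro d e hd he m x hx
    induction m with
    | zero => exact ⟨x, hx, by simp⟩
    | succ n ih =>
      obtain ⟨y, hy, hyx⟩ := ih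
      obtain ⟨z, hz, hzy⟩ := hstep hy hd he
      exact ⟨z, hz, by rw [hzy, hyx]; push_cast; ring⟩
    | pred n ih =>
      obtain ⟨y, hy, hyx⟩ := ih
      obtain ⟨z, hz, hzy⟩ := hstep hy he hd
      exact ⟨z, hz, by rw [hzy, hyx]; push_cast; ring⟩
  have hlattice : ∀ w ∈ hexLattice, ∃ x, HasIncrements G φ x 1 ∧ φ x = w := by
    rintro _ ⟨m, n, rfl⟩
    obtain ⟨y, hy, hy'⟩ := hline (d := 1) (e := jCube) (by simp) (by simp) m hv₀
    obtain ⟨z, hz, hz'⟩ := hline (d := 1) (e := jCube ^ 2) (by simp) (by simp) n hy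
    exact ⟨z, hz, by rw [hz', hy', h0]; ring⟩
  ext z
  constructor
  · rintro ⟨x, rfl⟩
    rcases hcoset x with h | h
    · exact Or.inl h.1
    · exact Or.inr ⟨_, h.1, by ring⟩
  · rintro (hz | ⟨w, hw, rfl⟩)
    · obtain ⟨x, -, hx⟩ := hlattice z hz
      exact ⟨x, hx⟩
    · obtain ⟨x, hx, rfl⟩ := hlattice w hw
      obtain ⟨y, -, hy⟩ := (hx 1).2 (Or.inl rfl)
      exact ⟨y, by rw [hy]; ring⟩
end

section
/- Let G be a 3-regular tree, let v₀ and v₁ be adjacent vertices, and let α ≠ β be complex numbers. If φ and ψ are holomorphic functions from the vertices of G to ℂ with φ(v₀) = ψ(v₀) = α and φ(v₁) = ψ(v₁) = β, then there exists a unique graph automorphism γ of G with γ(v₀) = v₀, γ(v₁) = v₁ and φ(γ(x)) = ψ(x) for every vertex x. (Equivalently, the group of automorphisms of G fixing v₀ and v₁ acts simply transitively on the space of holomorphic functions taking the values α and β at v₀ and v₁.) -/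
open scoped BigOperators

/-- Both `φ` and its square have vanishing Laplacian: the first two power sums of the differences
along the edges at each vertex are zero. -/
def IsDiscreteHolomorphic {V : Type*} (G : SimpleGraph V) (φ : V → ℂ) : Prop :=
  ∀ x : V, (∑ᶠ y ∈ G.neighborSet x, (φ y - φ x)) = 0 ∧
    (∑ᶠ y ∈ G.neighborSet x, (φ y - φ x) ^ 2) = 0

namespace IsDiscreteHolomorphic

variable {V : Type*} {G : SimpleGraph V} {φ ψ : V → ℂ}

/-- The differences at a vertex of degree three are the roots of a polynomial `X ^ 3 - e`. -/
theorem exists_neighbors (hφ : IsDiscreteHolomorphic G φ)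
    (hdeg : ∀ v : V, (G.neighborSet v).ncard = 3) (x : V) :
    ∃ a b c : V, a ≠ b ∧ a ≠ c ∧ b ≠ c ∧ G.neighborSet x = {a, b, c} ∧
      (φ a - φ x) + (φ b - φ x) + (φ c - φ x) = 0 ∧
      (φ a - φ x) ^ 2 + (φ b - φ x) ^ 2 + (φ c - φ x) ^ 2 = 0 := by
  obtain ⟨a, b, c, hab, hac, hbc, hN⟩ := Set.ncard_eq_three.1 (hdeg x)
  have key (f : V → ℂ) : ∑ᶠ y ∈ G.neighborSet x, f y = f a + f b + f c := by
    rw [hN, finsum_mem_insert f (by simp [hab, hac]) (Set.toFinite _), finsum_mem_pair hbc,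
      add_assoc]
  have h := hφ x
  rw [key, key] at h
  exact ⟨a, b, c, hab, hac, hbc, hN, h⟩

/-- A value occurs at a neighbor of `x` iff it solves the cubic equation given by any neighbor. -/
theorem exists_adj_eq_iff (hφ : IsDiscreteHolomorphic G φ)
    (hdeg : ∀ v : V, (G.neighborSet v).ncard = 3) {x y : V} (hxy : G.Adj x y) (z : ℂ) :
    (∃ w, G.Adj x w ∧ φ w = z) ↔ (z - φ x) ^ 3 = (φ y - φ x) ^ 3 := by
  obtain ⟨a, b, c, -, -, -, hN, h1, h2⟩ := hφ.exists_neighbors hdeg x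
  have hadj (w : V) : G.Adj x w ↔ w = a ∨ w = b ∨ w = c := by
    rw [← SimpleGraph.mem_neighborSet, hN]
    simp
  have hroots (t : ℂ) : (t - (φ a - φ x)) * (t - (φ b - φ x)) * (t - (φ c - φ x)) =
      t ^ 3 - (φ a - φ x) * (φ b - φ x) * (φ c - φ x) := by
    have hc : φ c - φ x = -(φ a - φ x) - (φ b - φ x) := by linear_combination h1
    rw [hc] at h2 ⊢
    linear_combination (-t / 2) * h2
  have hy : (φ y - φ x) ^ 3 = (φ a - φ x) * (φ b - φ x) * (φ c - φ x) := by
    refine sub_eq_zero.1 ?_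
    rw [← hroots]
    rcases (hadj y).1 hxy with rfl | rfl | rfl <;> simp
  rw [hy, ← sub_eq_zero, ← hroots]
  simp only [mul_eq_zero, sub_sub_sub_cancel_right, sub_eq_zero, hadj]
  grind

/-- The differences along two edges at the same vertex vanish simultaneously. -/
theorem ne_of_adj_of_ne (hφ : IsDiscreteHolomorphic G φ)
    (hdeg : ∀ v : V, (G.neighborSet v).ncard = 3) {x y w : V} (hxy : G.Adj x y)
    (hxw : G.Adj x w) (hne : φ y ≠ φ x) : φ w ≠ φ x := by
  intro h
  have := (hφ.exists_adj_eq_iff hdeg hxy (φ w)).1 ⟨w, hxw, rfl⟩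
  rw [h, sub_self, zero_pow three_ne_zero] at this
  exact hne (sub_eq_zero.1 (pow_eq_zero_iff three_ne_zero |>.1 this.symm))

/-- If the differences at `x` do not vanish, the values at the neighbors of `x` are distinct. -/
theorem injOn_neighborSet (hφ : IsDiscreteHolomorphic G φ)
    (hdeg : ∀ v : V, (G.neighborSet v).ncard = 3) {x y : V} (hxy : G.Adj x y)
    (hne : φ y ≠ φ x) : Set.InjOn φ (G.neighborSet x) := by
  have hne' (w : V) (hw : G.Adj x w) : φ w - φ x ≠ 0 :=
    sub_ne_zero.2 (hφ.ne_of_adj_of_ne hdeg hxy hw hne)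
  obtain ⟨a, b, c, hab, hac, hbc, hN, h1, h2⟩ := hφ.exists_neighbors hdeg x
  have ha := hne' a (by rw [← SimpleGraph.mem_neighborSet, hN]; simp)
  have hb := hne' b (by rw [← SimpleGraph.mem_neighborSet, hN]; simp)
  have aux (p q r : ℂ) (hp : p ≠ 0) (h1 : p + q + r = 0) (h2 : p ^ 2 + q ^ 2 + r ^ 2 = 0) :
      p ≠ q := by
    rintro rfl
    have hr : r = -2 * p := by linear_combination h1
    rw [hr] at h2
    have : p ^ 2 = 0 := by linear_combination h2 / 6
    exact hp (pow_eq_zero_iff two_ne_zero |>.1 this)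
  have dab : φ a ≠ φ b := fun h => aux _ _ _ ha h1 h2 (by rw [h])
  have dac : φ a ≠ φ c := fun h => aux _ (φ c - φ x) (φ b - φ x) ha
    (by linear_combination h1) (by linear_combination h2) (by rw [h])
  have dbc : φ b ≠ φ c := fun h => aux _ (φ c - φ x) (φ a - φ x) hb
    (by linear_combination h1) (by linear_combination h2) (by rw [h])
  rw [hN]
  rintro u (rfl | rfl | rfl) v (rfl | rfl | rfl) huv <;> first | rfl | grind

/-- A holomorphic function that is not constant along one edge is locally injective. -/
theorem injOn_neighborSet_of_connected (hφ : IsDiscreteHolomorphic G φ)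
    (hdeg : ∀ v : V, (G.neighborSet v).ncard = 3) (hconn : G.Connected) {v w : V}
    (hvw : G.Adj v w) (hne : φ w ≠ φ v) (x : V) : Set.InjOn φ (G.neighborSet x) := by
  suffices h : ∃ y, G.Adj x y ∧ φ y ≠ φ x by
    obtain ⟨y, hxy, hy⟩ := h
    exact hφ.injOn_neighborSet hdeg hxy hy
  obtain ⟨p⟩ := hconn.preconnected x v
  induction p with
  | nil => exact ⟨w, hvw, hne⟩
  | cons h _ ih =>
    obtain ⟨y, hxy, hy⟩ := ih hvw hne
    exact ⟨_, h, (hφ.ne_of_adj_of_ne hdeg hxy h.symm hy).symm⟩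

/-- If the values of `φ` and `ψ` match along one edge, then those of `ψ` at further neighbors
are also values of `φ`. -/
theorem exists_adj_eq_of_adj_eq (hφ : IsDiscreteHolomorphic G φ) (hψ : IsDiscreteHolomorphic G ψ)
    (hdeg : ∀ v : V, (G.neighborSet v).ncard = 3) {a a' b b' y : V} (ha : G.Adj a a')
    (hb : G.Adj b b') (h : φ a = ψ b) (h' : φ a' = ψ b') (hy : G.Adj b y) :
    ∃ x, G.Adj a x ∧ φ x = ψ y := by
  rw [hφ.exists_adj_eq_iff hdeg ha, h, h', ← hψ.exists_adj_eq_iff hdeg hb]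
  exact ⟨y, hy, rfl⟩

end IsDiscreteHolomorphic

namespace SimpleGraph

variable {V X : Type*} {G : SimpleGraph V} {φ ψ : V → X}

open Classical in
/-- The endpoint of the lift, starting at the end vertex, of the values of `ψ` along a walk to a
walk along which `φ` has the same values. -/
noncomputable def Walk.liftValues (φ ψ : V → X) : {u v : V} → G.Walk u v → V
  | u, _, .nil => u
  | u, _, .cons _ p =>
    if h : ∃ x, G.Adj (p.liftValues φ ψ) x ∧ φ x = ψ u then h.choose else u

theorem Walk.liftValues_cons {u v w : V} (h : G.Adj u v) (p : G.Walk v w)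
    (hex : ∃ x, G.Adj (p.liftValues φ ψ) x ∧ φ x = ψ u) :
    G.Adj (p.liftValues φ ψ) ((Walk.cons h p).liftValues φ ψ) ∧
      φ ((Walk.cons h p).liftValues φ ψ) = ψ u := by
  rw [Walk.liftValues, dif_pos hex]
  exact hex.choose_spec

theorem IsAcyclic.eq_cons_or_eq_cons (hG : G.IsAcyclic) {u v w : V} (h : G.Adj u v)
    {p : G.Walk u w} {q : G.Walk v w} (hp : p.IsPath) (hq : q.IsPath) :
    p = .cons h q ∨ q = .cons h.symm p := by
  classical
  have huniq {a b : V} {r s : G.Walk a b} (hr : r.IsPath) (hs : s.IsPath) : r = s :=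
    congrArg Subtype.val ((hG.subsingleton_path a b).elim ⟨r, hr⟩ ⟨s, hs⟩)
  by_cases hu : u ∈ q.support
  · right
    have h1 : q.takeUntil u hu = .cons h.symm .nil :=
      huniq (hq.takeUntil hu) (by simp [h.ne'])
    have h2 : q.dropUntil u hu = p := huniq (hq.dropUntil hu) hp
    rw [← q.take_spec hu, h1, h2]
    rfl
  · exact .inl (huniq hp (hq.cons hu))

/-- In a tree, a lifting property along edges gives a lift of `ψ` along `φ`. -/
theorem IsAcyclic.exists_hom_comp_eq (hG : G.IsAcyclic) (hconn : G.Connected) {v₀ v₁ : V}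
    (hadj : G.Adj v₀ v₁) (h₀ : φ v₀ = ψ v₀) (h₁ : φ v₁ = ψ v₁)
    (hstep : ∀ ⦃a a' b b' y : V⦄, G.Adj a a' → G.Adj b b' → φ a = ψ b → φ a' = ψ b' →
      G.Adj b y → ∃ x, G.Adj a x ∧ φ x = ψ y) :
    ∃ γ : G →g G, γ v₀ = v₀ ∧ ∀ x, φ (γ x) = ψ x := by
  have hlift {u : V} (p : G.Walk u v₀) : φ (p.liftValues φ ψ) = ψ u ∧
      ∃ a' b', G.Adj (p.liftValues φ ψ) a' ∧ G.Adj u b' ∧ φ a' = ψ b' := by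
    induction p with
    | nil => exact ⟨h₀, v₁, v₁, hadj, hadj, h₁⟩
    | cons h p ih =>
      obtain ⟨hp, a', b', ha, hb, hab⟩ := ih hadj h₀
      obtain ⟨hc, hc'⟩ := Walk.liftValues_cons h p (hstep ha hb hp hab h.symm)
      exact ⟨hc', _, _, hc.symm, h, hp⟩
  have hcons {u v : V} (h : G.Adj u v) (p : G.Walk v v₀) :
      G.Adj (p.liftValues φ ψ) ((Walk.cons h p).liftValues φ ψ) := by
    obtain ⟨hp, a', b', ha, hb, hab⟩ := hlift p
    exact (Walk.liftValues_cons h p (hstep ha hb hp hab h.symm)).1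
  choose P hP using fun u => (hconn u v₀).exists_isPath
  refine ⟨⟨fun u => (P u).liftValues φ ψ, fun {u v} h => ?_⟩, ?_, fun x => (hlift (P x)).1⟩
  · rcases hG.eq_cons_or_eq_cons h (hP u) (hP v) with e | e <;> rw [e]
    · exact (hcons h _).symm
    · exact hcons h.symm _
  · change (P v₀).liftValues φ ψ = v₀
    rw [(Walk.isPath_iff_nil.1 (hP v₀)).eq_nil]
    rfl

theorem Connected.hom_ext_of_injOn_neighborSet (hconn : G.Connected)
    (hinj : ∀ x, Set.InjOn φ (G.neighborSet x)) {f g : G →g G} {v₀ : V} (h₀ : f v₀ = g v₀)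
    (hfg : ∀ x, φ (f x) = φ (g x)) (x : V) : f x = g x := by
  obtain ⟨p⟩ := hconn.preconnected x v₀
  induction p with
  | nil => exact h₀
  | @cons u v _ h _ ih =>
    refine hinj (f v) (f.map_adj h.symm) ?_ (hfg u)
    rw [ih h₀]
    exact g.map_adj h.symm

end SimpleGraph

theorem stmt8 {V : Type*} (G : SimpleGraph V)
    (hconn : G.Connected) (hac : G.IsAcyclic)
    (hdeg : ∀ v : V, (G.neighborSet v).ncard = 3)
    (v₀ v₁ : V) (hadj : G.Adj v₀ v₁)
    (α β : ℂ) (hαβ : α ≠ β)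
    (φ ψ : V → ℂ)
    (hφ : ∀ x : V, (∑ᶠ y ∈ G.neighborSet x, (φ y - φ x)) = 0 ∧
                   (∑ᶠ y ∈ G.neighborSet x, (φ y - φ x) ^ 2) = 0)
    (hψ : ∀ x : V, (∑ᶠ y ∈ G.neighborSet x, (ψ y - ψ x)) = 0 ∧
                   (∑ᶠ y ∈ G.neighborSet x, (ψ y - ψ x) ^ 2) = 0)
    (hφ0 : φ v₀ = α) (hψ0 : ψ v₀ = α) (hφ1 : φ v₁ = β) (hψ1 : ψ v₁ = β) :
    ∃! γ : G ≃g G, γ v₀ = v₀ ∧ γ v₁ = v₁ ∧ ∀ x : V, φ (γ x) = ψ x := by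
  replace hφ : IsDiscreteHolomorphic G φ := hφ
  replace hψ : IsDiscreteHolomorphic G ψ := hψ
  have h₀ : φ v₀ = ψ v₀ := hφ0.trans hψ0.symm
  have h₁ : φ v₁ = ψ v₁ := hφ1.trans hψ1.symm
  have iφ := hφ.injOn_neighborSet_of_connected hdeg hconn hadj (by rw [hφ0, hφ1]; exact hαβ.symm)
  have iψ := hψ.injOn_neighborSet_of_connected hdeg hconn hadj (by rw [hψ0, hψ1]; exact hαβ.symm)
  obtain ⟨f, hf0, hf⟩ := hac.exists_hom_comp_eq hconn hadj h₀ h₁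
    fun _ _ _ _ _ => hφ.exists_adj_eq_of_adj_eq hψ hdeg
  obtain ⟨g, hg0, hg⟩ := hac.exists_hom_comp_eq hconn hadj h₀.symm h₁.symm
    fun _ _ _ _ _ => hψ.exists_adj_eq_of_adj_eq hφ hdeg
  have hfg (x : V) : f (g x) = x :=
    hconn.hom_ext_of_injOn_neighborSet iφ (f := f.comp g) (g := .id) (v₀ := v₀)
      (by simp [hf0, hg0]) (by simp [hf, hg]) x
  have hgf (x : V) : g (f x) = x :=
    hconn.hom_ext_of_injOn_neighborSet iψ (f := g.comp f) (g := .id) (v₀ := v₀)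
      (by simp [hf0, hg0]) (by simp [hf, hg]) x
  refine ⟨⟨⟨f, g, hgf, hfg⟩, fun {a b} => ⟨fun h => ?_, f.map_adj⟩⟩, ⟨hf0, ?_, hf⟩, ?_⟩
  · have := g.map_adj h
    simpa [hgf] using this
  · refine iφ v₀ ?_ hadj ((hf v₁).trans h₁.symm)
    have := f.map_adj hadj
    rwa [hf0] at this
  · rintro γ ⟨hγ0, -, hγ⟩
    ext x
    exact hconn.hom_ext_of_injOn_neighborSet iφ (f := γ.toHom) (g := f) (v₀ := v₀)
      (hγ0.trans hf0.symm) (fun y => (hγ y).trans (hf y).symm) x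
end

section
/- Let G be a 3-regular tree and let v₀ and v₁ be adjacent vertices. If φ and ψ are non-constant holomorphic functions from the vertices of G to ℂ, then there exist unique a ∈ ℂ with a ≠ 0, b ∈ ℂ, and graph automorphism γ of G with γ(v₀) = v₀ and γ(v₁) = v₁, such that ψ(x) = a·φ(γ(x)) + b for every vertex x. (Equivalently, the product of the similarity group of ℂ with the group of automorphisms of G fixing v₀ and v₁ acts simply transitively on the space of non-constant holomorphic functions on G.) -/
open scoped BigOperators

namespace SimpleGraph

variable {V : Type*} {G : SimpleGraph V} {φ ψ : V → ℂ} {c d : V → ℂ}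

/-- The values of `φ` at the neighbours of each vertex `x` are the three distinct cube roots of
`c x ≠ 0`, translated by `φ x`, each taken exactly once. -/
structure IsCubical (G : SimpleGraph V) (φ c : V → ℂ) : Prop where
  ne_zero : ∀ x, c x ≠ 0
  cube_eq_iff : ∀ x z, (z - φ x) ^ 3 = c x ↔ ∃ y, G.Adj x y ∧ φ y = z
  injOn : ∀ x y y', G.Adj x y → G.Adj x y' → φ y = φ y' → y = y'

lemma IsCubical.cube_eq (h : G.IsCubical φ c) {x y : V} (hxy : G.Adj x y) :
    (φ y - φ x) ^ 3 = c x :=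
  (h.cube_eq_iff x _).2 ⟨y, hxy, rfl⟩

lemma IsCubical.eq_neg_of_adj (h : G.IsCubical φ c) {x y : V} (hxy : G.Adj x y) :
    c y = -c x := by
  rw [← h.cube_eq hxy, ← h.cube_eq hxy.symm]
  ring

lemma IsCubical.affine (h : G.IsCubical φ c) {a : ℂ} (ha : a ≠ 0) (b : ℂ) :
    G.IsCubical (fun x ↦ a * φ x + b) (fun x ↦ a ^ 3 * c x) where
  ne_zero x := mul_ne_zero (pow_ne_zero _ ha) (h.ne_zero x)
  cube_eq_iff x z := by
    have key : (z - (a * φ x + b)) ^ 3 = a ^ 3 * ((z - b) / a - φ x) ^ 3 := by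
      field_simp
      ring
    rw [key, mul_right_inj' (pow_ne_zero _ ha), h.cube_eq_iff]
    refine exists_congr fun y ↦ and_congr_right fun _ ↦ ?_
    rw [eq_div_iff ha, eq_sub_iff_add_eq, mul_comm]
  injOn x y y' hy hy' e :=
    h.injOn x y y' hy hy' (mul_left_cancel₀ ha (add_right_cancel e))

lemma exists_cube_of_harmonic_of_harmonic_sq {x : V} (hdeg : (G.neighborSet x).ncard = 3)
    (h₁ : (∑ᶠ y ∈ G.neighborSet x, (φ y - φ x)) = 0)
    (h₂ : (∑ᶠ y ∈ G.neighborSet x, (φ y - φ x) ^ 2) = 0) :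
    ∃ c : ℂ, (∀ z, (z - φ x) ^ 3 = c ↔ ∃ y, G.Adj x y ∧ φ y = z) ∧
      (c ≠ 0 → ∀ y y', G.Adj x y → G.Adj x y' → φ y = φ y' → y = y') := by
  classical
  obtain ⟨u, v, w, huv, huw, hvw, hN⟩ := Set.ncard_eq_three.1 hdeg
  have hsum (f : V → ℂ) : ∑ᶠ y ∈ G.neighborSet x, f y = f u + f v + f w := by
    have : G.neighborSet x = (({u, v, w} : Finset V) : Set V) := by simp [hN]
    rw [this, finsum_mem_coe_finset, Finset.sum_insert (by simp [huv, huw]),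
      Finset.sum_pair hvw, add_assoc]
  have hadj (y : V) : G.Adj x y ↔ y = u ∨ y = v ∨ y = w := by
    rw [← mem_neighborSet, hN]
    simp
  rw [hsum] at h₁ h₂
  obtain ⟨p, hp⟩ : ∃ p, p = φ u - φ x := ⟨_, rfl⟩
  obtain ⟨q, hq⟩ : ∃ q, q = φ v - φ x := ⟨_, rfl⟩
  obtain ⟨r, hr⟩ : ∃ r, r = φ w - φ x := ⟨_, rfl⟩
  rw [← hp, ← hq, ← hr] at h₁ h₂
  have hr' : r = -p - q := by linear_combination h₁
  have hpq : p ^ 2 + p * q + q ^ 2 = 0 := by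
    rw [hr'] at h₂
    linear_combination h₂ / 2
  have h_double {s t : ℂ} (hst : s = t) (h : s ^ 2 + s * t + t ^ 2 = 0) : s = 0 := by
    subst hst
    have : s ^ 2 = 0 := by linear_combination h / 3
    exact pow_eq_zero_iff two_ne_zero |>.1 this
  have hpr : p ^ 2 + p * r + r ^ 2 = 0 := by rw [hr']; linear_combination hpq
  have hqr : q ^ 2 + q * r + r ^ 2 = 0 := by rw [hr']; linear_combination hpq
  refine ⟨p * q * r, fun z ↦ ?_, fun hc ↦ ?_⟩
  · have hfac : (z - φ x) ^ 3 - p * q * r = (z - φ u) * (z - φ v) * (z - φ w) := by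
      have hu : φ u = p + φ x := by rw [hp]; ring
      have hv : φ v = q + φ x := by rw [hq]; ring
      have hw : φ w = r + φ x := by rw [hr]; ring
      rw [hu, hv, hw, hr']
      linear_combination (z - φ x) * hpq
    rw [← sub_eq_zero, hfac]
    simp only [mul_eq_zero, sub_eq_zero, hadj, or_and_right, exists_or, exists_eq_left]
    simp only [eq_comm, or_assoc]
  · have hpq' : φ u ≠ φ v := fun e ↦ hc <| by rw [h_double (by rw [hp, hq, e]) hpq]; ring
    have hpr' : φ u ≠ φ w := fun e ↦ hc <| by rw [h_double (by rw [hp, hr, e]) hpr]; ring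
    have hqr' : φ v ≠ φ w := fun e ↦ hc <| by rw [h_double (by rw [hq, hr, e]) hqr]; ring
    intro y y' hy hy' e
    rw [hadj] at hy hy'
    rcases hy with rfl | rfl | rfl <;> rcases hy' with rfl | rfl | rfl <;>
      first | rfl | exact absurd e ‹_› | exact absurd e.symm ‹_›

/-- A vertex property that passes to neighbours holds everywhere on a connected graph. -/
lemma Connected.forall_of_adj_s9 (hconn : G.Connected) {P : V → Prop} {x : V} (hx : P x)
    (hstep : ∀ y z, G.Adj y z → P y → P z) (y : V) : P y := by
  obtain ⟨p⟩ := hconn.preconnected x y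
  induction p with
  | nil => exact hx
  | cons h _ ih => exact ih (hstep _ _ h hx)

lemma Connected.exists_isCubical (hconn : G.Connected)
    (hdeg : ∀ v : V, (G.neighborSet v).ncard = 3) (hnc : ¬ ∀ x y : V, φ x = φ y)
    (hφ : ∀ x : V, (∑ᶠ y ∈ G.neighborSet x, (φ y - φ x)) = 0 ∧
                   (∑ᶠ y ∈ G.neighborSet x, (φ y - φ x) ^ 2) = 0) :
    ∃ c, G.IsCubical φ c := by
  choose c hc hinj using fun x ↦
    exists_cube_of_harmonic_of_harmonic_sq (hdeg x) (hφ x).1 (hφ x).2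
  have hne (x : V) : c x ≠ 0 := by
    intro hx
    refine hnc ?_
    have hconst := hconn.forall_of_adj_s9 (P := fun y ↦ c y = 0 ∧ φ y = φ x) ⟨hx, rfl⟩ <| by
      rintro y z hyz ⟨hy, hyx⟩
      have hz := (hc y _).2 ⟨z, hyz, rfl⟩
      have hzy := (hc z _).2 ⟨y, hyz.symm, rfl⟩
      rw [hy, pow_eq_zero_iff three_ne_zero, sub_eq_zero] at hz
      rw [hz, sub_self, zero_pow three_ne_zero] at hzy
      exact ⟨hzy.symm, hz.trans hyx⟩
    intro y z
    rw [(hconst y).2, (hconst z).2]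
  exact ⟨c, hne, hc, fun x ↦ hinj x (hne x)⟩

/-- Maps that lift the same function along a cubical one, and agree at a vertex, are equal. -/
lemma IsCubical.hom_ext (h : G.IsCubical φ c) (hconn : G.Connected) {f g : G →g G} {x : V}
    (hx : f x = g x) (hfg : ∀ y, φ (f y) = φ (g y)) (y : V) : f y = g y :=
  hconn.forall_of_adj_s9 (P := fun y ↦ f y = g y) hx
    (fun y z hyz hy ↦ h.injOn (f y) _ _ (f.map_adj hyz) (hy ▸ g.map_adj hyz) (hfg z)) y

open Classical in
/-- A neighbour of `u` where `φ` takes the value `z`, if there is one. -/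
noncomputable def neighborOfValue (G : SimpleGraph V) (φ : V → ℂ) (u : V) (z : ℂ) : V :=
  if h : ∃ y, G.Adj u y ∧ φ y = z then h.choose else u

lemma neighborOfValue_spec {u : V} {z : ℂ} (h : ∃ y, G.Adj u y ∧ φ y = z) :
    G.Adj u (G.neighborOfValue φ u z) ∧ φ (G.neighborOfValue φ u z) = z := by
  rw [neighborOfValue, dif_pos h]
  exact h.choose_spec

/-- The end of the lift, starting at `v`, of a walk to `v` traversed backwards, whose
`φ`-values are the `ψ`-values along the walk. -/
noncomputable def liftEnd (φ ψ : V → ℂ) {v : V} : ∀ {x : V}, G.Walk x v → V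
  | _, .nil => v
  | x, .cons _ p => G.neighborOfValue φ (liftEnd φ ψ p) (ψ x)

lemma IsCubical.exists_adj_of_eq (hφ : G.IsCubical φ c) (hψ : G.IsCubical ψ d) {x y u : V}
    (hxy : G.Adj y x) (hu : φ u = ψ y) (hc : c u = d y) : ∃ w, G.Adj u w ∧ φ w = ψ x := by
  rw [← hφ.cube_eq_iff, hu, hc, hψ.cube_eq hxy]

lemma IsCubical.liftEnd_spec (hφ : G.IsCubical φ c) (hψ : G.IsCubical ψ d) {v x : V}
    (hv : φ v = ψ v) (hc : c v = d v) (p : G.Walk x v) :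
    φ (liftEnd φ ψ p) = ψ x ∧ c (liftEnd φ ψ p) = d x := by
  induction p with
  | nil => exact ⟨hv, hc⟩
  | cons h p ih =>
    obtain ⟨ih₁, ih₂⟩ := ih hv hc
    have hw := neighborOfValue_spec (hφ.exists_adj_of_eq hψ h.symm ih₁ ih₂)
    refine ⟨hw.2, ?_⟩
    rw [liftEnd, hφ.eq_neg_of_adj hw.1, ih₂, hψ.eq_neg_of_adj h.symm]

lemma IsCubical.exists_hom (hφ : G.IsCubical φ c) (hψ : G.IsCubical ψ d) (hconn : G.Connected)
    (hac : G.IsAcyclic) {v : V} (hv : φ v = ψ v) (hc : c v = d v) :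
    ∃ f : G →g G, f v = v ∧ ∀ x, φ (f x) = ψ x := by
  classical
  choose p hp using fun x ↦ hconn.exists_isPath x v
  have hstep {x y : V} (h : G.Adj x y) (hx : x ∉ (p y).support) :
      G.Adj (liftEnd φ ψ (p y)) (liftEnd φ ψ (p x)) := by
    have e : p x = .cons h (p y) :=
      congrArg Subtype.val ((hac.subsingleton_path x v).elim ⟨_, hp x⟩ ⟨_, (hp y).cons hx⟩)
    obtain ⟨h₁, h₂⟩ := hφ.liftEnd_spec hψ hv hc (p y)
    rw [e]
    exact (neighborOfValue_spec (hφ.exists_adj_of_eq hψ h.symm h₁ h₂)).1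
  refine ⟨⟨fun x ↦ liftEnd φ ψ (p x), fun {x y} h ↦ ?_⟩, ?_, fun x ↦
    (hφ.liftEnd_spec hψ hv hc (p x)).1⟩
  · by_cases hx : x ∈ (p y).support
    · suffices y ∉ (p x).support from hstep h.symm this
      simpa using hac.ne_mem_support_of_support_of_adj_of_isPath (hp y).reverse (hp x).reverse
        h.symm (by simpa using hx)
    · exact (hstep h hx).symm
  · have e : p v = .nil := by simpa using hp v
    change liftEnd φ ψ (p v) = v
    rw [e, liftEnd]

lemma IsCubical.exists_iso (hφ : G.IsCubical φ c) (hψ : G.IsCubical ψ d) (hconn : G.Connected)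
    (hac : G.IsAcyclic) {v : V} (hv : φ v = ψ v) (hc : c v = d v) :
    ∃ γ : G ≃g G, γ v = v ∧ ∀ x, φ (γ x) = ψ x := by
  obtain ⟨f, hfv, hf⟩ := hφ.exists_hom hψ hconn hac hv hc
  obtain ⟨g, hgv, hg⟩ := hψ.exists_hom hφ hconn hac hv.symm hc.symm
  have hgf : ∀ x, g (f x) = x :=
    hψ.hom_ext hconn (f := g.comp f) (g := .id) (x := v) (by simp [hfv, hgv]) (by simp [hf, hg])
  have hfg : ∀ x, f (g x) = x :=
    hφ.hom_ext hconn (f := f.comp g) (g := .id) (x := v) (by simp [hfv, hgv]) (by simp [hf, hg])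
  refine ⟨⟨⟨f, g, hgf, hfg⟩, fun {x y} ↦ ⟨fun h ↦ ?_, f.map_adj⟩⟩, hfv, hf⟩
  simpa [hgf] using g.map_adj h

end SimpleGraph



theorem stmt9 {V : Type*} (G : SimpleGraph V)
    (hconn : G.Connected) (hac : G.IsAcyclic)
    (hdeg : ∀ v : V, (G.neighborSet v).ncard = 3)
    (v₀ v₁ : V) (hadj : G.Adj v₀ v₁)
    (φ ψ : V → ℂ)
    (hφnc : ¬ ∀ x y : V, φ x = φ y) (hψnc : ¬ ∀ x y : V, ψ x = ψ y)
    (hφ : ∀ x : V, (∑ᶠ y ∈ G.neighborSet x, (φ y - φ x)) = 0 ∧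
                   (∑ᶠ y ∈ G.neighborSet x, (φ y - φ x) ^ 2) = 0)
    (hψ : ∀ x : V, (∑ᶠ y ∈ G.neighborSet x, (ψ y - ψ x)) = 0 ∧
                   (∑ᶠ y ∈ G.neighborSet x, (ψ y - ψ x) ^ 2) = 0) :
    ∃! p : ℂ × ℂ × (G ≃g G),
      p.1 ≠ 0 ∧ p.2.2 v₀ = v₀ ∧ p.2.2 v₁ = v₁ ∧
      ∀ x : V, ψ x = p.1 * φ (p.2.2 x) + p.2.1 := by
  obtain ⟨c, hc⟩ := hconn.exists_isCubical hdeg hφnc hφ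
  obtain ⟨d, hd⟩ := hconn.exists_isCubical hdeg hψnc hψ
  have hφ₀ : φ v₁ - φ v₀ ≠ 0 := by
    intro h
    have := hc.cube_eq hadj
    rw [h, zero_pow three_ne_zero] at this
    exact hc.ne_zero v₀ this.symm
  have hψ₀ : ψ v₁ - ψ v₀ ≠ 0 := by
    intro h
    have := hd.cube_eq hadj
    rw [h, zero_pow three_ne_zero] at this
    exact hd.ne_zero v₀ this.symm
  obtain ⟨a, ha⟩ : ∃ a, a = (ψ v₁ - ψ v₀) / (φ v₁ - φ v₀) := ⟨_, rfl⟩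
  have ha₀ : a ≠ 0 := ha ▸ div_ne_zero hψ₀ hφ₀
  have ha₁ : a * (φ v₁ - φ v₀) = ψ v₁ - ψ v₀ := by rw [ha, div_mul_cancel₀ _ hφ₀]
  have hc' := hc.affine ha₀ (ψ v₀ - a * φ v₀)
  obtain ⟨γ, hγ₀, hγ⟩ := hc'.exists_iso hd hconn hac (v := v₀) (by ring) <| by
    rw [← hd.cube_eq hadj, ← hc.cube_eq hadj, ← ha₁]
    ring
  have hγ₁ : γ v₁ = v₁ := by
    refine hc'.injOn v₀ _ _ (by simpa [hγ₀] using γ.map_adj_iff.2 hadj) hadj ?_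
    rw [hγ]
    linear_combination -ha₁
  refine ⟨⟨a, ψ v₀ - a * φ v₀, γ⟩, ⟨ha₀, hγ₀, hγ₁, fun x ↦ (hγ x).symm⟩, ?_⟩
  rintro ⟨a', b', γ'⟩ ⟨-, hγ₀', hγ₁', hγ'⟩
  dsimp only at hγ₀' hγ₁' hγ'
  have h₀ := hγ' v₀
  have h₁ := hγ' v₁
  rw [hγ₀'] at h₀
  rw [hγ₁'] at h₁
  obtain rfl : a' = a := mul_right_cancel₀ hφ₀ (by linear_combination h₀ - h₁ - ha₁)
  obtain rfl : b' = ψ v₀ - a' * φ v₀ := by linear_combination -h₀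
  have : γ' = γ := by
    ext x
    exact hc'.hom_ext hconn (f := γ'.toHom) (g := γ.toHom) (x := v₀)
      (hγ₀'.trans hγ₀.symm) (fun y ↦ ((hγ' y).symm.trans (hγ y).symm)) x
  rw [this]
end

section
/- Let G be a connected simple graph in which every vertex has degree 3, and suppose G contains a cycle of length at most 5. Then every holomorphic function φ from the vertices of G to ℂ is constant. -/
open scoped BigOperators

/-- If three complex numbers and also their squares sum to zero, then any two of them, `u` and `v`,
satisfy `u ^ 2 + u * v + v ^ 2 = 0`. -/
lemma sq_add_mul_add_sq_eq_zero_of_ncard_eq_three {V : Type*} {N : Set V} (hN : N.ncard = 3)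
    {f : V → ℂ} (h₁ : ∑ᶠ y ∈ N, f y = 0) (h₂ : ∑ᶠ y ∈ N, f y ^ 2 = 0)
    {y z : V} (hy : y ∈ N) (hz : z ∈ N) (hyz : y ≠ z) :
    f y ^ 2 + f y * f z + f z ^ 2 = 0 := by
  classical
  obtain ⟨a, b, c, hab, hac, hbc, rfl⟩ := Set.ncard_eq_three.1 hN
  have hsum : ∀ g : V → ℂ, ∑ᶠ y ∈ ({a, b, c} : Set V), g y = g a + (g b + g c) := by
    intro g
    have hcoe : ({a, b, c} : Set V) = (({a, b, c} : Finset V) : Set V) := by simp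
    rw [hcoe, finsum_mem_coe_finset, Finset.sum_insert (by simp [hab, hac]),
      Finset.sum_insert (by simp [hbc]), Finset.sum_singleton]
  rw [hsum] at h₁ h₂
  simp only [Set.mem_insert_iff, Set.mem_singleton_iff] at hy hz
  rcases hy with rfl | rfl | rfl <;> rcases hz with rfl | rfl | rfl <;>
    first | exact absurd rfl hyz | grind

/-- A function whose differences along any two distinct edges at a vertex satisfy
`u ^ 2 + u * v + v ^ 2 = 0` is constant on a connected graph once it is constant along one edge. -/
lemma SimpleGraph.Connected.eq_of_adj_eq {V : Type*} {G : SimpleGraph V} (hconn : G.Connected)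
    {φ : V → ℂ}
    (hφ : ∀ x y z : V, G.Adj x y → G.Adj x z → y ≠ z →
      (φ y - φ x) ^ 2 + (φ y - φ x) * (φ z - φ x) + (φ z - φ x) ^ 2 = 0)
    {a b : V} (hab : G.Adj a b) (h : φ a = φ b) (x y : V) : φ x = φ y := by
  have step : ∀ u v w : V, G.Adj u v → φ u = φ v → G.Adj v w → φ v = φ w := by
    intro u v w huv he hvw
    by_cases huw : u = w
    · rw [← huw, he]
    · have := hφ v u w huv.symm hvw huw
      rw [he] at this
      grind
  have along : ∀ {v w : V} (_ : G.Walk v w) (u : V), G.Adj u v → φ u = φ v → φ v = φ w := by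
    intro v w p
    induction p with
    | nil => intros; rfl
    | cons hadj _ ih =>
      intro u huv he
      have hstep := step u _ _ huv he hadj
      exact hstep.trans (ih _ hadj hstep)
  have hb : ∀ w, φ b = φ w := fun w ↦ along (hconn.preconnected b w).some a hab h
  rw [← hb x, ← hb y]

theorem stmt10 {V : Type*} (G : SimpleGraph V)
    (hconn : G.Connected)
    (hdeg : ∀ v : V, (G.neighborSet v).ncard = 3)
    (hcyc : ∃ (v : V) (c : G.Walk v v), c.IsCycle ∧ c.length ≤ 5)
    (φ : V → ℂ)
    (hhol : ∀ x : V, (∑ᶠ y ∈ G.neighborSet x, (φ y - φ x)) = 0 ∧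
                     (∑ᶠ y ∈ G.neighborSet x, (φ y - φ x) ^ 2) = 0) :
    ∀ x y : V, φ x = φ y := by
  have key : ∀ x y z : V, G.Adj x y → G.Adj x z → y ≠ z →
      (φ y - φ x) ^ 2 + (φ y - φ x) * (φ z - φ x) + (φ z - φ x) ^ 2 = 0 :=
    fun x y z hy hz hyz ↦ sq_add_mul_add_sq_eq_zero_of_ncard_eq_three
      (f := fun y ↦ φ y - φ x) (hdeg x) (hhol x).1 (hhol x).2 hy hz hyz
  have cubes : ∀ x y z : V, G.Adj x y → G.Adj y z → x ≠ z →
      (φ y - φ x) ^ 3 + (φ z - φ y) ^ 3 = 0 := by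
    intro x y z hxy hyz hxz
    have := key y x z hxy.symm hyz hxz
    linear_combination (φ z - φ x) * this
  obtain ⟨v, c, hc, hlen⟩ := hcyc
  have hnodup := hc.support_nodup
  have hthree := hc.three_le_length
  match c, hnodup, hthree, hlen with
  | .cons (v := a) h₁ (.cons (v := b) h₂ (.cons h₃ .nil)), hnd, _, _ =>
    simp at hnd
    refine hconn.eq_of_adj_eq key h₁ ?_
    have e₁ := cubes v a b h₁ h₂ (by grind)
    have e₂ := cubes a b v h₂ h₃ (by grind)
    have e₃ := cubes b v a h₃ h₁ (by grind)
    have : (φ a - φ v) ^ 3 = 0 := by linear_combination (e₁ - e₂ + e₃) / 2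
    exact (sub_eq_zero.1 (pow_eq_zero_iff three_ne_zero |>.1 this)).symm
  | .cons (v := a) h₁ (.cons (v := b) h₂ (.cons (v := d) h₃ (.cons h₄ .nil))), hnd, _, _ =>
    simp at hnd
    refine hconn.eq_of_adj_eq key h₁ ?_
    have e₁ := key a v b h₁.symm h₂ (by grind)
    have e₂ := key b a d h₂.symm h₃ (by grind)
    have e₃ := key d b v h₃.symm h₄ (by grind)
    have e₄ := key v d a h₄.symm h₁ (by grind)
    grind
  | .cons (v := a) h₁ (.cons (v := b) h₂ (.cons (v := d) h₃ (.cons (v := e) h₄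
      (.cons h₅ .nil)))), hnd, _, _ =>
    simp at hnd
    refine hconn.eq_of_adj_eq key h₁ ?_
    have e₁ := cubes v a b h₁ h₂ (by grind)
    have e₂ := cubes a b d h₂ h₃ (by grind)
    have e₃ := cubes b d e h₃ h₄ (by grind)
    have e₄ := cubes d e v h₄ h₅ (by grind)
    have e₅ := cubes e v a h₅ h₁ (by grind)
    have : (φ a - φ v) ^ 3 = 0 := by linear_combination (e₁ - e₂ + e₃ - e₄ + e₅) / 2
    exact (sub_eq_zero.1 (pow_eq_zero_iff three_ne_zero |>.1 this)).symm
end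

section
/- Let ν ≥ 4 be an integer and let G be a nonempty connected acyclic simple graph in which every vertex has degree ν (a homogeneous tree of valency ν). Let f be a harmonic function from the vertices of G to ℝ whose gradient has constant norm 1, i.e. Σ_{y ∈ N(x)} (f(y) − f(x))² = 1 for every vertex x. Then f has a conjugate part: there exists g from the vertices of G to ℝ such that φ = f + i·g is holomorphic, i.e. both φ and φ² are harmonic. -/
open scoped BigOperators

section Extension

variable {ι : Type*} [Fintype ι] [DecidableEq ι] {a b : ι → ℝ}

/-- The orthogonal projection of the indicator of `i` onto the complement of the constants and of
the unit vector `a`, where `a` is orthogonal to the constants. -/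
noncomputable def indicatorProj (a : ι → ℝ) (i j : ι) : ℝ :=
  (if j = i then 1 else 0) - 1 / Fintype.card ι - a i * a j

theorem sum_indicatorProj_mul (a b : ι → ℝ) (i : ι) :
    ∑ j, indicatorProj a i j * b j =
      b i - 1 / Fintype.card ι * ∑ j, b j - a i * ∑ j, a j * b j := by
  simp [indicatorProj, sub_mul, Finset.sum_sub_distrib, Finset.mul_sum, mul_assoc]

theorem sum_indicatorProj (ha : ∑ j, a j = 0) (i : ι) : ∑ j, indicatorProj a i j = 0 := by
  have : Nonempty ι := ⟨i⟩
  simp [indicatorProj, Finset.sum_sub_distrib, ← Finset.mul_sum, ha]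

theorem sum_mul_indicatorProj (ha : ∑ j, a j = 0) (ha2 : ∑ j, a j ^ 2 = 1) (i : ι) :
    ∑ j, a j * indicatorProj a i j = 0 := by
  simp_rw [mul_comm (a _), sum_indicatorProj_mul, ← sq, ha, ha2]
  ring

theorem sum_indicatorProj_sq (ha : ∑ j, a j = 0) (ha2 : ∑ j, a j ^ 2 = 1) (i : ι) :
    ∑ j, indicatorProj a i j ^ 2 = 1 - 1 / Fintype.card ι - a i ^ 2 := by
  simp_rw [sq (indicatorProj a i _)]
  rw [sum_indicatorProj_mul, sum_indicatorProj ha, sum_mul_indicatorProj ha ha2]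
  simp [indicatorProj, sq]

theorem indicatorProj_self (a : ι → ℝ) (i : ι) :
    indicatorProj a i i = 1 - 1 / Fintype.card ι - a i ^ 2 := by
  simp [indicatorProj, sq]

theorem one_sub_sub_sq_nonneg (ha : ∑ j, a j = 0) (ha2 : ∑ j, a j ^ 2 = 1) (i : ι) :
    0 ≤ 1 - 1 / (Fintype.card ι : ℝ) - a i ^ 2 := by
  rw [← sum_indicatorProj_sq ha ha2]
  positivity

theorem sq_le_of_orthogonal (ha : ∑ j, a j = 0) (ha2 : ∑ j, a j ^ 2 = 1)
    (hb : ∑ j, b j = 0) (hab : ∑ j, a j * b j = 0) (hb2 : ∑ j, b j ^ 2 = 1) (i : ι) :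
    b i ^ 2 ≤ 1 - 1 / Fintype.card ι - a i ^ 2 := by
  have h := Finset.sum_mul_sq_le_sq_mul_sq Finset.univ (indicatorProj a i) b
  rw [sum_indicatorProj_mul, hb, hab, hb2, sum_indicatorProj_sq ha ha2] at h
  simpa using h

theorem exists_unit_orthogonal (hcard : 4 ≤ Fintype.card ι) (a : ι → ℝ) (i : ι) :
    ∃ w : ι → ℝ, ∑ j, w j = 0 ∧ ∑ j, a j * w j = 0 ∧ w i = 0 ∧ ∑ j, w j ^ 2 = 1 := by
  let M : Matrix (Fin 3) ι ℝ := ![fun _ => 1, a, Pi.single i 1]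
  have hker : LinearMap.ker M.mulVecLin ≠ ⊥ :=
    LinearMap.ker_ne_bot_of_finrank_lt (by simp; omega)
  obtain ⟨v, hv, hv0⟩ := (Submodule.ne_bot_iff _).mp hker
  rw [LinearMap.mem_ker, Matrix.mulVecLin_apply] at hv
  have h0 : ∑ j, v j = 0 := by
    simpa [M, Matrix.mulVec, dotProduct] using congrFun hv 0
  have h1 : ∑ j, a j * v j = 0 := by
    simpa [M, Matrix.mulVec, dotProduct] using congrFun hv 1
  have h2 : v i = 0 := by
    simpa [M, Matrix.mulVec, dotProduct, Pi.single_apply] using congrFun hv 2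
  have hpos : 0 < ∑ j, v j ^ 2 := by
    obtain ⟨k, hk⟩ := Function.ne_iff.mp hv0
    exact Finset.sum_pos' (fun j _ => sq_nonneg _) ⟨k, Finset.mem_univ _, sq_pos_of_ne_zero hk⟩
  set c := (√(∑ j, v j ^ 2))⁻¹ with hc
  have hc2 : c ^ 2 = (∑ j, v j ^ 2)⁻¹ := by rw [hc, inv_pow, Real.sq_sqrt hpos.le]
  refine ⟨fun j => c * v j, ?_, ?_, ?_, ?_⟩
  · rw [← Finset.mul_sum, h0, mul_zero]
  · simp_rw [mul_left_comm (a _), ← Finset.mul_sum, h1, mul_zero]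
  · simp only [h2, mul_zero]
  · simp_rw [mul_pow, ← Finset.mul_sum, hc2]
    exact inv_mul_cancel₀ hpos.ne'

theorem exists_unit_orthogonal_apply_eq (hcard : 4 ≤ Fintype.card ι) (ha : ∑ j, a j = 0)
    (ha2 : ∑ j, a j ^ 2 = 1) (i : ι) {β : ℝ}
    (hβ : β ^ 2 ≤ 1 - 1 / Fintype.card ι - a i ^ 2) :
    ∃ b : ι → ℝ, ∑ j, b j = 0 ∧ ∑ j, a j * b j = 0 ∧ ∑ j, b j ^ 2 = 1 ∧ b i = β := by
  obtain ⟨w, hw, haw, hwi, hw2⟩ := exists_unit_orthogonal hcard a i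
  set q := 1 - 1 / (Fintype.card ι : ℝ) - a i ^ 2 with hq
  have hq0 : 0 ≤ q := one_sub_sub_sq_nonneg ha ha2 i
  obtain ⟨s, hsβ, hs⟩ : ∃ s : ℝ, s * q = β ∧ s ^ 2 * q ≤ 1 := by
    rcases hq0.eq_or_lt with h | h
    · refine ⟨0, ?_, by simp⟩
      rw [← h] at hβ
      rw [zero_mul, pow_eq_zero_iff two_ne_zero |>.mp (hβ.antisymm (sq_nonneg β))]
    · refine ⟨β / q, div_mul_cancel₀ _ h.ne', ?_⟩
      rw [div_pow, sq q, div_mul_eq_mul_div, mul_div_mul_right _ _ h.ne']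
      exact div_le_one_of_le₀ hβ h.le
  set t := √(1 - s ^ 2 * q) with ht
  have ht2 : t ^ 2 = 1 - s ^ 2 * q := Real.sq_sqrt (by linarith)
  have hpw : ∑ j, indicatorProj a i j * w j = 0 := by
    rw [sum_indicatorProj_mul, hw, haw, hwi]; ring
  refine ⟨fun j => s * indicatorProj a i j + t * w j, ?_, ?_, ?_, ?_⟩
  · rw [Finset.sum_add_distrib, ← Finset.mul_sum, ← Finset.mul_sum, hw, sum_indicatorProj ha]
    ring
  · have (j : ι) : a j * (s * indicatorProj a i j + t * w j) =
        s * (a j * indicatorProj a i j) + t * (a j * w j) := by ring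
    simp_rw [this]
    rw [Finset.sum_add_distrib, ← Finset.mul_sum, ← Finset.mul_sum, haw,
      sum_mul_indicatorProj ha ha2]
    ring
  · have (j : ι) : (s * indicatorProj a i j + t * w j) ^ 2 =
        s ^ 2 * indicatorProj a i j ^ 2 + 2 * s * t * (indicatorProj a i j * w j) +
          t ^ 2 * w j ^ 2 := by ring
    simp_rw [this]
    rw [Finset.sum_add_distrib, Finset.sum_add_distrib, ← Finset.mul_sum, ← Finset.mul_sum,
      ← Finset.mul_sum, hpw, hw2, sum_indicatorProj_sq ha ha2, ht2]
    ring
  · simp only [indicatorProj_self, ← hq, hwi, mul_zero, add_zero, hsβ]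

end Extension

theorem exists_recursive_function {V A : Type*} (ℓ : V → ℕ) (par : V → V)
    (hpar : ∀ x, ℓ x ≠ 0 → ℓ x = ℓ (par x) + 1) (a : A) (step : V → A → A) :
    ∃ S : V → A, (∀ x, ℓ x = 0 → S x = a) ∧ ∀ x, ℓ x ≠ 0 → S x = step x (S (par x)) := by
  let F (n : ℕ) : V → A := Nat.rec (fun _ => a) (fun _ T x => step x (T (par x))) n
  refine ⟨fun x => F (ℓ x) x, fun x hx => ?_, fun x hx => ?_⟩
  · simp [hx, F]
  · simp only [hpar x hx, F]

namespace SimpleGraph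

variable {V : Type*} {G : SimpleGraph V}

theorem IsAcyclic.eq_of_adj_of_dist_eq (hac : G.IsAcyclic) (hconn : G.Connected) {r x y z : V}
    (hxz : G.Adj x z) (hyz : G.Adj y z) (hx : G.dist r z = G.dist r x + 1)
    (hy : G.dist r z = G.dist r y + 1) : x = y := by
  obtain ⟨p, hp⟩ := hconn.exists_walk_length_eq_dist r x
  obtain ⟨q, hq⟩ := hconn.exists_walk_length_eq_dist r y
  have hp' := (p.concat hxz).isPath_of_length_eq_dist (by rw [Walk.length_concat, hp, hx])
  have hq' := (q.concat hyz).isPath_of_length_eq_dist (by rw [Walk.length_concat, hq, hy])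
  have h := congrArg (fun w : G.Path r z => w.1.penultimate)
    ((hac.subsingleton_path r z).elim ⟨_, hp'⟩ ⟨_, hq'⟩)
  simpa using h

theorem Connected.exists_adj_dist_eq (hconn : G.Connected) {r x : V} (h : G.dist r x ≠ 0) :
    ∃ y, G.Adj x y ∧ G.dist r x = G.dist r y + 1 := by
  obtain ⟨p, hp⟩ := hconn.exists_walk_length_eq_dist r x
  have hnil : ¬p.Nil := fun hn => h (by rw [← hp, Walk.length_eq_zero_iff.mpr hn])
  have hadj := p.adj_penultimate hnil
  have h1 : G.dist r p.penultimate ≤ p.dropLast.length := dist_le _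
  have h2 : p.dropLast.length + 1 = p.length := by
    simp [Walk.dropLast]; omega
  refine ⟨p.penultimate, hadj.symm, ?_⟩
  have := hadj.diff_dist_adj (u := r)
  omega

/-- Unit vectors on the stars of a tree that extend any admissible value at the parent of the
vertex are the increments of a global function. -/
theorem IsTree.exists_increments (hG : G.IsTree) (r : V) (par : V → V)
    (hadj : ∀ x, G.Adj x (par x))
    (hpar : ∀ x, G.dist r x ≠ 0 → G.dist r x = G.dist r (par x) + 1)
    (P : ∀ x, (G.neighborSet x → ℝ) → Prop) (R : V → ℝ → Prop) (hr : R r 0)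
    (hR : ∀ x (b : G.neighborSet x → ℝ) y, P x b → par y.1 = x → R y.1 (- b y))
    (hext : ∀ x β, R x β → ∃ b, P x b ∧ b ⟨par x, hadj x⟩ = β) :
    ∃ g : V → ℝ, ∀ x, P x (fun y => g y - g x) := by
  have hext' : ∀ x β, ∃ b, R x β → P x b ∧ b ⟨par x, hadj x⟩ = β := by
    intro x β
    by_cases h : R x β
    · obtain ⟨b, hb⟩ := hext x β h
      exact ⟨b, fun _ => hb⟩
    · exact ⟨0, fun h' => (h h').elim⟩
  choose B hB using hext'
  obtain ⟨S, hS0, hS⟩ := exists_recursive_function (G.dist r) par hpar ((0 : ℝ), (0 : ℝ))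
    fun x T => (T.1 + B (par x) T.2 ⟨x, (hadj x).symm⟩, - B (par x) T.2 ⟨x, (hadj x).symm⟩)
  have hRS : ∀ n x, G.dist r x = n → R x (S x).2 := by
    intro n
    induction n with
    | zero =>
      intro x hx
      obtain rfl := hG.connected.dist_eq_zero_iff.mp hx
      rwa [hS0 _ hx]
    | succ n ih =>
      intro x hx
      have hx0 : G.dist r x ≠ 0 := by omega
      rw [hS x hx0]
      exact hR _ _ ⟨x, (hadj x).symm⟩ (hB _ _ (ih _ (by have := hpar x hx0; omega))).1 rfl
  refine ⟨fun x => (S x).1, fun x => ?_⟩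
  obtain ⟨hP, hb⟩ := hB x _ (hRS _ x rfl)
  convert hP using 2 with y
  obtain ⟨y, hxy⟩ := y
  have hxy' : G.Adj x y := hxy
  rcases hG.dist_eq_dist_add_one_of_adj r hxy' with h | h
  · change (S y).1 - (S x).1 = _
    have hx0 : G.dist r x ≠ 0 := by omega
    obtain rfl := hG.isAcyclic.eq_of_adj_of_dist_eq hG.connected (hadj x).symm hxy'.symm
      (hpar x hx0) h
    rw [hb]
    simp only [hS x hx0]
    ring
  · change (S y).1 - (S x).1 = _
    have hy0 : G.dist r y ≠ 0 := by omega
    obtain rfl := hG.isAcyclic.eq_of_adj_of_dist_eq hG.connected (hadj y).symm hxy'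
      (hpar y hy0) h
    rw [hS y hy0]
    ring

end SimpleGraph



theorem stmt15 (ν : ℕ) (hν : 4 ≤ ν) {V : Type*} (G : SimpleGraph V)
    (hconn : G.Connected) (hac : G.IsAcyclic)
    (hdeg : ∀ v : V, (G.neighborSet v).ncard = ν)
    (f : V → ℝ)
    (hharm : ∀ x : V, (∑ᶠ y ∈ G.neighborSet x, (f y - f x)) = 0)
    (hgrad : ∀ x : V, (∑ᶠ y ∈ G.neighborSet x, (f y - f x) ^ 2) = 1) :
    ∃ g : V → ℝ, ∀ x : V,
      (∑ᶠ y ∈ G.neighborSet x,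
        (((f y : ℂ) + Complex.I * (g y : ℂ)) - ((f x : ℂ) + Complex.I * (g x : ℂ)))) = 0 ∧
      (∑ᶠ y ∈ G.neighborSet x,
        (((f y : ℂ) + Complex.I * (g y : ℂ)) - ((f x : ℂ) + Complex.I * (g x : ℂ))) ^ 2) = 0 := by
  classical
  have hG : G.IsTree := ⟨hconn, hac⟩
  have hfin (x : V) : (G.neighborSet x).Finite :=
    Set.finite_of_ncard_pos (by rw [hdeg]; omega)
  let _ (x : V) : Fintype (G.neighborSet x) := (hfin x).fintype
  have hcard (x : V) : Fintype.card (G.neighborSet x) = ν := by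
    rw [← hdeg x, ← Nat.card_coe_set_eq, Nat.card_eq_fintype_card]
  have hsum {M : Type} [AddCommMonoid M] (x : V) (F : V → M) :
      ∑ᶠ y ∈ G.neighborSet x, F y = ∑ y : G.neighborSet x, F y := by
    rw [← finsum_set_coe_eq_finsum_mem, finsum_eq_sum_of_fintype]
  simp only [hsum] at hharm hgrad ⊢
  obtain ⟨r⟩ := hconn.nonempty
  have hparent : ∀ x, ∃ y, G.Adj x y ∧ (G.dist r x ≠ 0 → G.dist r x = G.dist r y + 1) := by
    intro x
    by_cases h : G.dist r x = 0
    · have : Nonempty (G.neighborSet x) :=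
        Fintype.card_pos_iff.mp (by rw [hcard]; omega)
      obtain ⟨y, hy⟩ := this
      exact ⟨y, hy, fun h' => (h' h).elim⟩
    · obtain ⟨y, hxy, hy⟩ := hconn.exists_adj_dist_eq h
      exact ⟨y, hxy, fun _ => hy⟩
  choose par hadj hpar using hparent
  have key : ∃ g : V → ℝ, ∀ x, ∑ y : G.neighborSet x, (g y - g x) = 0 ∧
      ∑ y : G.neighborSet x, (f y - f x) * (g y - g x) = 0 ∧
      ∑ y : G.neighborSet x, (g y - g x) ^ 2 = 1 := by
    refine hG.exists_increments r par hadj hpar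
      (fun x b => ∑ y, b y = 0 ∧ ∑ y, (f y.1 - f x) * b y = 0 ∧ ∑ y, b y ^ 2 = 1)
      (fun x β => β ^ 2 ≤ 1 - 1 / ν - (f (par x) - f x) ^ 2) ?_ ?_ ?_
    · have h := one_sub_sub_sq_nonneg (hharm r) (hgrad r) ⟨par r, hadj r⟩
      rw [hcard] at h
      simpa using h
    · rintro x b y ⟨h0, h1, h2⟩ hxy
      have h := sq_le_of_orthogonal (hharm _) (hgrad _) h0 h1 h2 y
      rw [hcard] at h
      rw [neg_sq, hxy, ← neg_sub (f y), neg_sq]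
      exact h
    · intro x β hβ
      obtain ⟨b, h0, h1, h2, hb⟩ := exists_unit_orthogonal_apply_eq (by rw [hcard]; exact hν)
        (hharm x) (hgrad x) ⟨par x, hadj x⟩ (β := β) (by rwa [hcard])
      exact ⟨b, ⟨h0, h1, h2⟩, hb⟩
  obtain ⟨g, hg⟩ := key
  refine ⟨g, fun x => ?_⟩
  obtain ⟨h0, h1, h2⟩ := hg x
  constructor
  · have (y : G.neighborSet x) : ((f y : ℂ) + Complex.I * g y) - (f x + Complex.I * g x) =
        ((f y - f x : ℝ) : ℂ) + Complex.I * ((g y - g x : ℝ) : ℂ) := by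
      push_cast; ring
    simp_rw [this]
    rw [Finset.sum_add_distrib, ← Finset.mul_sum, ← Complex.ofReal_sum, ← Complex.ofReal_sum,
      hharm, h0]
    simp
  · have (y : G.neighborSet x) :
        (((f y : ℂ) + Complex.I * g y) - (f x + Complex.I * g x)) ^ 2 =
        (((f y - f x) ^ 2 : ℝ) : ℂ) - (((g y - g x) ^ 2 : ℝ) : ℂ) +
          2 * Complex.I * (((f y - f x) * (g y - g x) : ℝ) : ℂ) := by
      push_cast
      linear_combination ((g y : ℂ) - g x) ^ 2 * Complex.I_sq
    simp_rw [this]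
    rw [Finset.sum_add_distrib, Finset.sum_sub_distrib, ← Finset.mul_sum,
      ← Complex.ofReal_sum, ← Complex.ofReal_sum, ← Complex.ofReal_sum, hgrad, h1, h2]
    simp
end

section
/- Let n ≥ 4 and let δ = (δ₁, …, δₙ) ∈ ℝⁿ, δ ≠ 0, with Σᵢ δᵢ = 0 and Σᵢ δᵢ² = 1. Then the image under the projection onto the first coordinate of the set C = {a = (a₁, …, aₙ) ∈ ℝⁿ : Σᵢ aᵢ δᵢ = 0, Σᵢ aᵢ² = 1, Σᵢ aᵢ = 0} is exactly the closed interval [−α, α], where α = √((n−1)/n − δ₁²). In particular this image depends only on δ₁. -/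
open scoped BigOperators

/-- A unit vector orthogonal to `1` and `δ` with vanishing `k`-th coordinate. -/
theorem exists_unit_vector_orthogonal {ι : Type*} [Fintype ι] (hι : 4 ≤ Fintype.card ι)
    (k : ι) (δ : ι → ℝ) :
    ∃ w : ι → ℝ, w k = 0 ∧ ∑ i, w i = 0 ∧ ∑ i, w i * δ i = 0 ∧ ∑ i, w i ^ 2 = 1 := by
  let f : (ι → ℝ) →ₗ[ℝ] ℝ × ℝ × ℝ :=
    (LinearMap.proj k).prod ((∑ i, LinearMap.proj i).prod (∑ i, δ i • LinearMap.proj i))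
  have hf : LinearMap.ker f ≠ ⊥ := by
    apply LinearMap.ker_ne_bot_of_finrank_lt
    simp only [Module.finrank_prod, Module.finrank_self, Module.finrank_fintype_fun_eq_card]
    omega
  obtain ⟨u, hu, hu0⟩ := Submodule.exists_mem_ne_zero_of_ne_bot hf
  have hfu : u k = 0 ∧ ∑ i, u i = 0 ∧ ∑ i, δ i * u i = 0 := by
    simpa [f, LinearMap.mem_ker, Prod.ext_iff] using hu
  obtain ⟨hk, hs, hd⟩ := hfu
  obtain ⟨j, hj⟩ := Function.ne_iff.mp hu0
  have hpos : 0 < ∑ i, u i ^ 2 :=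
    Finset.sum_pos' (fun i _ => sq_nonneg _) ⟨j, Finset.mem_univ j, sq_pos_of_ne_zero hj⟩
  refine ⟨fun i => (√(∑ i, u i ^ 2))⁻¹ * u i, by simp [hk], ?_, ?_, ?_⟩
  · rw [← Finset.mul_sum, hs, mul_zero]
  · simp_rw [mul_assoc, ← Finset.mul_sum, mul_comm (u _), hd, mul_zero]
  · simp_rw [mul_pow, ← Finset.mul_sum, inv_pow, Real.sq_sqrt hpos.le]
    exact inv_mul_cancel₀ hpos.ne'

/-- The orthogonal projection of the `k`-th basis vector to the complement of `1` and `δ`. -/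
theorem exists_projection_basis_vector {ι : Type*} [Fintype ι] (k : ι) (δ : ι → ℝ)
    (h1 : ∑ i, δ i = 0) (h2 : ∑ i, δ i ^ 2 = 1) :
    ∃ v : ι → ℝ, v k = ((Fintype.card ι : ℝ) - 1) / Fintype.card ι - δ k ^ 2 ∧
      ∑ i, v i = 0 ∧ ∑ i, v i * δ i = 0 ∧
      ∀ a : ι → ℝ, ∑ i, a i = 0 → ∑ i, a i * δ i = 0 → ∑ i, a i * v i = a k := by
  classical
  have hc : (Fintype.card ι : ℝ) ≠ 0 := by
    have : Nonempty ι := ⟨k⟩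
    exact_mod_cast Fintype.card_ne_zero
  refine ⟨fun i => (if i = k then 1 else 0) - (Fintype.card ι : ℝ)⁻¹ - δ k * δ i, ?_, ?_, ?_, ?_⟩
  · simp only [if_true]
    field_simp
  · simp [Finset.sum_sub_distrib, ← Finset.mul_sum, h1, hc]
  · simp_rw [sub_mul, Finset.sum_sub_distrib, mul_assoc, ← Finset.mul_sum, ← sq, h1, h2]
    simp
  · intro a ha hd
    simp_rw [mul_sub, Finset.sum_sub_distrib, mul_left_comm (a _), ← Finset.mul_sum,
      ← Finset.sum_mul, ha, hd]
    simp

theorem stmt16 (n : ℕ) (hn : 4 ≤ n) (δ : Fin n → ℝ) (hδ : δ ≠ 0)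
    (h1 : (∑ i, δ i) = 0) (h2 : (∑ i, (δ i) ^ 2) = 1) :
    (fun a : Fin n → ℝ => a ⟨0, by omega⟩) ''
        {a : Fin n → ℝ |
          (∑ i, a i * δ i) = 0 ∧ (∑ i, (a i) ^ 2) = 1 ∧ (∑ i, a i) = 0} =
      Set.Icc (-(Real.sqrt (((n : ℝ) - 1) / n - (δ ⟨0, by omega⟩) ^ 2)))
        (Real.sqrt (((n : ℝ) - 1) / n - (δ ⟨0, by omega⟩) ^ 2)) := by
  generalize_proofs hk
  obtain ⟨v, hvk, hvs, hvd, hv⟩ := exists_projection_basis_vector ⟨0, hk⟩ δ h1 h2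
  obtain ⟨w, hwk, hws, hwd, hw⟩ :=
    exists_unit_vector_orthogonal (by simpa using hn) (⟨0, hk⟩ : Fin n) δ
  rw [Fintype.card_fin] at hvk
  rw [← hvk]
  generalize (⟨0, hk⟩ : Fin n) = k at *
  have hvv : ∑ i, v i ^ 2 = v k := by simpa only [sq] using hv v hvs hvd
  have hwv : ∑ i, w i * v i = 0 := by rw [hv w hws hwd, hwk]
  have hA : 0 ≤ v k := hvv ▸ Finset.sum_nonneg fun i _ => sq_nonneg (v i)
  ext x
  rw [Set.mem_Icc, ← abs_le, Set.mem_image]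
  constructor
  · rintro ⟨a, ⟨had, haa, has⟩, rfl⟩
    apply Real.abs_le_sqrt
    have := Finset.sum_mul_sq_le_sq_mul_sq Finset.univ a v
    rwa [hv a has had, haa, hvv, one_mul] at this
  · intro hx
    have hx2 : x ^ 2 ≤ v k := (Real.le_sqrt (abs_nonneg x) hA).mp hx |>.trans' (sq_abs x).ge
    have hs : √(1 - x ^ 2 / v k) ^ 2 = 1 - x ^ 2 / v k :=
      Real.sq_sqrt (sub_nonneg.mpr (div_le_one_of_le₀ hx2 hA))
    set s := √(1 - x ^ 2 / v k)
    refine ⟨fun i => x / v k * v i + s * w i, ⟨?_, ?_, ?_⟩, ?_⟩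
    · simp_rw [add_mul, Finset.sum_add_distrib, mul_assoc, ← Finset.mul_sum, hvd, hwd]
      simp
    · have hexp : ∀ i, (x / v k * v i + s * w i) ^ 2 =
          (x / v k) ^ 2 * v i ^ 2 + 2 * (x / v k) * s * (w i * v i) + s ^ 2 * w i ^ 2 :=
        fun i => by ring
      simp_rw [hexp, Finset.sum_add_distrib, ← Finset.mul_sum, hvv, hwv, hw, hs]
      rcases eq_or_ne (v k) 0 with h0 | h0
      · simp [h0]
      · field_simp
        ring
    · simp_rw [Finset.sum_add_distrib, ← Finset.mul_sum, hvs, hws]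
      simp
    · simp only [hwk, mul_zero, add_zero]
      refine div_mul_cancel_of_imp fun h0 => ?_
      exact pow_eq_zero_iff two_ne_zero |>.mp (le_antisymm (h0 ▸ hx2) (sq_nonneg x))
end

section
/- There exist a connected acyclic simple graph G in which every vertex has degree 4 (a 4-regular tree) and a harmonic function f from the vertices of G to ℝ which has no conjugate part: there is no function g from the vertices of G to ℝ such that f + i·g and (f + i·g)² are both harmonic. -/
open scoped BigOperators

namespace FourRegularTree

/-- Vertices of the 4-regular tree, seen as two rooted ternary trees whose roots are joined by an
edge: a vertex is the choice of a side and the path to it from the root of that side, read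
backwards. -/
abbrev Vertex : Type := Bool × List (Fin 3)

/-- The neighbor of a vertex towards the central edge; each root is the parent of the other. -/
def parent : Vertex → Vertex
  | (b, []) => (!b, [])
  | (b, _ :: l) => (b, l)

/-- The neighbors of a vertex: its parent and its three children. -/
def neighbor (x : Vertex) : Option (Fin 3) → Vertex
  | none => parent x
  | some c => (x.1, c :: x.2)

lemma parent_ne (x : Vertex) : parent x ≠ x := by
  rcases x with ⟨b, _ | ⟨c, l⟩⟩ <;> simp [parent]

/-- The 4-regular tree. -/
def tree : SimpleGraph Vertex where
  Adj x y := y = parent x ∨ x = parent y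
  symm := ⟨fun _ _ h => h.symm⟩
  loopless := ⟨fun x h => parent_ne x (by rcases h with h | h <;> exact h.symm)⟩

lemma tree_adj {x y : Vertex} : tree.Adj x y ↔ y = parent x ∨ x = parent y := Iff.rfl

lemma neighbor_injective (x : Vertex) : Function.Injective (neighbor x) := by
  rcases x with ⟨b, _ | ⟨c, l⟩⟩ <;> rintro (_ | i) (_ | j) h <;> simp_all [neighbor, parent]
  all_goals
    have := congrArg List.length h
    simp at this
    try omega

lemma neighborSet_tree (x : Vertex) : tree.neighborSet x = Set.range (neighbor x) := by
  ext y
  rw [SimpleGraph.mem_neighborSet, tree_adj]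
  constructor
  · rintro (rfl | h)
    · exact ⟨none, rfl⟩
    · rcases y with ⟨b, _ | ⟨c, l⟩⟩
      · exact ⟨none, by simp [h, neighbor, parent]⟩
      · exact ⟨some c, by simp [h, neighbor, parent]⟩
  · rintro ⟨_ | c, rfl⟩
    · exact Or.inl rfl
    · exact Or.inr rfl

lemma ncard_neighborSet_tree (x : Vertex) : (tree.neighborSet x).ncard = 4 := by
  rw [neighborSet_tree, ← Nat.card_coe_set_eq,
    Nat.card_range_of_injective (neighbor_injective x)]
  simp

lemma finsum_neighborSet_tree {M : Type*} [AddCommMonoid M] (x : Vertex) (F : Vertex → M) :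
    ∑ᶠ y ∈ tree.neighborSet x, F y = F (parent x) + ∑ c : Fin 3, F (x.1, c :: x.2) := by
  rw [neighborSet_tree, finsum_mem_range (neighbor_injective x), finsum_eq_sum_of_fintype,
    Fintype.sum_option]
  rfl

lemma tree_connected : tree.Connected := by
  have hroot (x : Vertex) : tree.Reachable x (x.1, []) := by
    rcases x with ⟨b, l⟩
    induction l with
    | nil => rfl
    | cons c l ih =>
      exact (SimpleGraph.Adj.reachable (tree_adj.2 (Or.inl rfl))).trans ih
  have hroots (b b' : Bool) : tree.Reachable (b, []) (b', []) := by
    by_cases h : b = b'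
    · rw [h]
    · refine SimpleGraph.Adj.reachable (tree_adj.2 (Or.inl ?_))
      cases b <;> cases b' <;> simp_all [parent]
  have : Nonempty Vertex := ⟨(true, [])⟩
  exact ⟨fun x y => (hroot x).trans ((hroots _ _).trans (hroot y).symm)⟩

/-- The vertices below `v`, that is, those on the side of `v` of the edge to its parent. -/
def descendants (v : Vertex) : Set Vertex := {u | u.1 = v.1 ∧ v.2 <:+ u.2}

lemma parent_notMem_descendants (v : Vertex) : parent v ∉ descendants v := by
  rcases v with ⟨b, _ | ⟨c, l⟩⟩
  · simp [descendants, parent]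
  · rintro ⟨-, h⟩
    have := h.length_le
    simp [parent] at this

lemma mem_descendants_of_adj {v u w : Vertex} (hu : u ∈ descendants v) (h : tree.Adj u w)
    (hne : s(u, w) ≠ s(v, parent v)) : w ∈ descendants v := by
  rcases u with ⟨b, m⟩
  rcases v with ⟨b', l⟩
  obtain ⟨rfl, hs⟩ : b = b' ∧ l <:+ m := hu
  rw [← SimpleGraph.mem_neighborSet, neighborSet_tree] at h
  obtain ⟨_ | c, rfl⟩ := h
  · cases m with
    | nil =>
      obtain rfl := List.suffix_nil.1 hs
      exact absurd rfl hne
    | cons d m =>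
      rcases List.suffix_cons_iff.1 hs with rfl | hs
      · exact absurd rfl hne
      · exact ⟨rfl, hs⟩
  · exact ⟨rfl, hs.trans (List.suffix_cons _ _)⟩

lemma not_reachable_parent (v : Vertex) :
    ¬ (tree.deleteEdges {s(v, parent v)}).Reachable v (parent v) := by
  rintro ⟨p⟩
  have hwalk {a b : Vertex} (q : (tree.deleteEdges {s(v, parent v)}).Walk a b)
      (ha : a ∈ descendants v) : b ∈ descendants v := by
    induction q with
    | nil => exact ha
    | cons h _ ih =>
      rw [SimpleGraph.deleteEdges_adj] at h
      exact ih (mem_descendants_of_adj ha h.1 h.2)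
  exact parent_notMem_descendants v (hwalk p ⟨rfl, List.suffix_rfl⟩)

lemma tree_isAcyclic : tree.IsAcyclic := by
  rw [SimpleGraph.isAcyclic_iff_forall_adj_isBridge]
  intro v w h
  rw [SimpleGraph.isBridge_iff]
  rcases h with rfl | rfl
  · exact not_reachable_parent v
  · rw [Sym2.eq_swap]
    exact fun h => not_reachable_parent w h.symm

/-- The increment of `potential` along the edge from the parent of a vertex of the side `false`
to that vertex. -/
noncomputable def increment : List (Fin 3) → ℝ
  | [] => 0
  | [c] => ![1, 1, -2] c
  | _ :: d :: l => increment (d :: l) / 3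

/-- A harmonic function on the 4-regular tree vanishing on the side `true`. -/
noncomputable def potential : Vertex → ℝ
  | (true, _) => 0
  | (false, []) => 0
  | (false, c :: l) => potential (false, l) + increment (c :: l)

lemma potential_harmonic (x : Vertex) :
    ∑ᶠ y ∈ tree.neighborSet x, (potential y - potential x) = 0 := by
  rw [finsum_neighborSet_tree, Fin.sum_univ_three]
  rcases x with ⟨_ | _, _ | ⟨c, l⟩⟩ <;> simp [potential, parent, increment] <;> ring

/-- At a vertex whose children all carry the same increment, the increment of a conjugate part
along the edge to the parent vanishes. -/
lemma eq_parent_of_conjugate {f g : Vertex → ℝ} {x : Vertex} {a : ℝ} (ha : a ≠ 0)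
    (hp : f (parent x) - f x = -(3 * a)) (hc : ∀ c, f (x.1, c :: x.2) - f x = a)
    (hsum : g (parent x) - g x + ∑ c : Fin 3, (g (x.1, c :: x.2) - g x) = 0)
    (hprod : (f (parent x) - f x) * (g (parent x) - g x) +
      ∑ c : Fin 3, (f (x.1, c :: x.2) - f x) * (g (x.1, c :: x.2) - g x) = 0) :
    g (parent x) = g x := by
  simp only [hp, hc, ← Finset.mul_sum] at hprod
  have : a * (g (parent x) - g x) = 0 := by linear_combination (a * hsum - hprod) / 4
  exact sub_eq_zero.1 ((mul_eq_zero.1 this).resolve_left ha)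

lemma conjugate_relations {f g : Vertex → ℝ} {x : Vertex}
    (h₁ : (∑ᶠ y ∈ tree.neighborSet x,
      (((f y : ℂ) + Complex.I * (g y : ℂ)) - ((f x : ℂ) + Complex.I * (g x : ℂ)))) = 0)
    (h₂ : (∑ᶠ y ∈ tree.neighborSet x,
      (((f y : ℂ) + Complex.I * (g y : ℂ)) - ((f x : ℂ) + Complex.I * (g x : ℂ))) ^ 2) = 0) :
    g (parent x) - g x + ∑ c : Fin 3, (g (x.1, c :: x.2) - g x) = 0 ∧
    (f (parent x) - f x) ^ 2 + ∑ c : Fin 3, (f (x.1, c :: x.2) - f x) ^ 2 =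
      (g (parent x) - g x) ^ 2 + ∑ c : Fin 3, (g (x.1, c :: x.2) - g x) ^ 2 ∧
    (f (parent x) - f x) * (g (parent x) - g x) +
      ∑ c : Fin 3, (f (x.1, c :: x.2) - f x) * (g (x.1, c :: x.2) - g x) = 0 := by
  rw [finsum_neighborSet_tree, Fin.sum_univ_three] at h₁ h₂
  have him := congrArg Complex.im h₁
  have hre₂ := congrArg Complex.re h₂
  have him₂ := congrArg Complex.im h₂
  simp [pow_two] at him hre₂ him₂
  simp only [Fin.sum_univ_three]
  refine ⟨?_, ?_, ?_⟩
  · linear_combination him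
  · linear_combination hre₂
  · linear_combination him₂ / 2

end FourRegularTree

open FourRegularTree in
theorem stmt17 :
    ∃ (V : Type) (G : SimpleGraph V) (f : V → ℝ),
      G.Connected ∧ G.IsAcyclic ∧ (∀ v : V, (G.neighborSet v).ncard = 4) ∧
      (∀ x : V, (∑ᶠ y ∈ G.neighborSet x, (f y - f x)) = 0) ∧
      ¬ ∃ g : V → ℝ, ∀ x : V,
          (∑ᶠ y ∈ G.neighborSet x,
            (((f y : ℂ) + Complex.I * (g y : ℂ)) - ((f x : ℂ) + Complex.I * (g x : ℂ)))) = 0 ∧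
          (∑ᶠ y ∈ G.neighborSet x,
            (((f y : ℂ) + Complex.I * (g y : ℂ)) - ((f x : ℂ) + Complex.I * (g x : ℂ))) ^ 2) = 0 := by
  refine ⟨Vertex, tree, potential, tree_connected, tree_isAcyclic, ncard_neighborSet_tree,
    potential_harmonic, ?_⟩
  rintro ⟨g, hg⟩
  have hchild (c : Fin 3) : g (false, []) = g (false, [c]) := by
    obtain ⟨hsum, -, hprod⟩ := conjugate_relations (hg (false, [c])).1 (hg (false, [c])).2
    refine eq_parent_of_conjugate (x := (false, [c])) (a := increment [c] / 3) ?_ ?_ ?_ hsum hprod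
    · fin_cases c <;> simp [increment]
    · simp [potential, parent]
      ring
    · simp [potential, increment]
  obtain ⟨hsum, hsq, -⟩ := conjugate_relations (hg (false, [])).1 (hg (false, [])).2
  simp only [← hchild, sub_self, Finset.sum_const_zero, add_zero] at hsum hsq
  rw [hsum] at hsq
  simp [Fin.sum_univ_three, potential, parent, increment] at hsq
  norm_num at hsq
end

section
/- Let U ⊆ ℂ be an open set and let φ : ℂ → ℂ be twice continuously differentiable (over ℝ) on U; write φ = f + i·g with f, g : ℂ → ℝ. Then φ and φ² are harmonic on U if and only if f and g are harmonic on U and, at every point of U, ‖∇f‖ = ‖∇g‖ and ⟨∇f, ∇g⟩ = 0, i.e. (∂f/∂x)² + (∂f/∂y)² = (∂g/∂x)² + (∂g/∂y)² and (∂f/∂x)(∂g/∂x) + (∂f/∂y)(∂g/∂y) = 0. In other words, φ is holomorphic in the sense that φ and φ² are harmonic if and only if φ is harmonic and semi-conformal. -/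
/-- The Laplacian of a complex-valued function on `ℂ ≅ ℝ²`:
`Δh = ∂²h/∂x² + ∂²h/∂y²`, the second derivatives being taken along the
directions `1` and `I`. -/
noncomputable def lap2C (h : ℂ → ℂ) (z : ℂ) : ℂ :=
  fderiv ℝ (fun w => fderiv ℝ h w 1) z 1 +
    fderiv ℝ (fun w => fderiv ℝ h w Complex.I) z Complex.I

/-- The Laplacian of a real-valued function on `ℂ ≅ ℝ²`. -/
noncomputable def lap2R (h : ℂ → ℝ) (z : ℂ) : ℝ :=
  fderiv ℝ (fun w => fderiv ℝ h w 1) z 1 +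
    fderiv ℝ (fun w => fderiv ℝ h w Complex.I) z Complex.I

theorem ContDiffAt.eventually_differentiableAt {E F : Type*} [NormedAddCommGroup E]
    [NormedSpace ℝ E] [NormedAddCommGroup F] [NormedSpace ℝ F] {h : E → F} {z : E}
    (hh : ContDiffAt ℝ 2 h z) : ∀ᶠ w in nhds z, DifferentiableAt ℝ h w := by
  filter_upwards [hh.eventually (by simp)] with w hw
  exact hw.differentiableAt (by simp)

theorem ContDiffAt.differentiableAt_fderiv_apply {E F : Type*} [NormedAddCommGroup E]
    [NormedSpace ℝ E] [NormedAddCommGroup F] [NormedSpace ℝ F] {h : E → F} {z : E}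
    (hh : ContDiffAt ℝ 2 h z) (v : E) : DifferentiableAt ℝ (fun w => fderiv ℝ h w v) z := by
  have h1 : ContDiffAt ℝ 1 (fderiv ℝ h) z := hh.fderiv_right (by norm_num)
  exact (h1.differentiableAt (by simp)).clm_apply (differentiableAt_const v)

theorem DifferentiableAt.fderiv_clm_comp_apply {E F G : Type*} [NormedAddCommGroup E]
    [NormedSpace ℝ E] [NormedAddCommGroup F] [NormedSpace ℝ F] [NormedAddCommGroup G]
    [NormedSpace ℝ G] {h : E → F} {z : E} (hh : DifferentiableAt ℝ h z) (L : F →L[ℝ] G) (v : E) :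
    fderiv ℝ (fun u => L (h u)) z v = L (fderiv ℝ h z v) :=
  congrArg (fun T => T v) (L.hasFDerivAt.comp z hh.hasFDerivAt).fderiv

theorem ContDiffAt.fderiv_fderiv_clm_comp {E F G : Type*} [NormedAddCommGroup E]
    [NormedSpace ℝ E] [NormedAddCommGroup F] [NormedSpace ℝ F] [NormedAddCommGroup G]
    [NormedSpace ℝ G] {h : E → F} {z : E} (hh : ContDiffAt ℝ 2 h z) (L : F →L[ℝ] G) (v : E) :
    fderiv ℝ (fun w => fderiv ℝ (fun u => L (h u)) w v) z v =
      L (fderiv ℝ (fun w => fderiv ℝ h w v) z v) := by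
  have key : (fun w => fderiv ℝ (fun u => L (h u)) w v) =ᶠ[nhds z]
      fun w => L (fderiv ℝ h w v) := by
    filter_upwards [hh.eventually_differentiableAt] with w hw
    exact hw.fderiv_clm_comp_apply L v
  rw [key.fderiv_eq, (hh.differentiableAt_fderiv_apply v).fderiv_clm_comp_apply L v]

theorem ContDiffAt.fderiv_fderiv_sq {E : Type*} [NormedAddCommGroup E]
    [NormedSpace ℝ E] {h : E → ℂ} {z : E} (hh : ContDiffAt ℝ 2 h z) (v : E) :
    fderiv ℝ (fun w => fderiv ℝ (fun u => h u ^ 2) w v) z v =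
      2 * (h z * fderiv ℝ (fun w => fderiv ℝ h w v) z v + fderiv ℝ h z v ^ 2) := by
  have key : (fun w => fderiv ℝ (fun u => h u ^ 2) w v) =ᶠ[nhds z]
      fun w => 2 * (h w * fderiv ℝ h w v) := by
    filter_upwards [hh.eventually_differentiableAt] with w hw
    rw [(hw.hasFDerivAt.pow 2).fderiv]
    simp [mul_assoc]
  have hd : DifferentiableAt ℝ h z := hh.differentiableAt (by simp)
  have hd' := hh.differentiableAt_fderiv_apply v
  rw [key.fderiv_eq, fderiv_const_mul (hd.fun_mul hd'), fderiv_fun_mul hd hd']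
  simp
  ring

theorem lap2R_clm_comp {h : ℂ → ℂ} {z : ℂ} (hh : ContDiffAt ℝ 2 h z) (L : ℂ →L[ℝ] ℝ) :
    lap2R (fun w => L (h w)) z = L (lap2C h z) := by
  simp only [lap2R, lap2C, hh.fderiv_fderiv_clm_comp, map_add]

theorem lap2C_sq {h : ℂ → ℂ} {z : ℂ} (hh : ContDiffAt ℝ 2 h z) :
    lap2C (fun w => h w ^ 2) z =
      2 * (h z * lap2C h z + (fderiv ℝ h z 1 ^ 2 + fderiv ℝ h z Complex.I ^ 2)) := by
  simp only [lap2C, hh.fderiv_fderiv_sq]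
  ring

theorem Complex.sq_add_sq_eq_zero_iff (a b : ℂ) :
    a ^ 2 + b ^ 2 = 0 ↔
      a.re ^ 2 + b.re ^ 2 = a.im ^ 2 + b.im ^ 2 ∧ a.re * a.im + b.re * b.im = 0 := by
  simp only [Complex.ext_iff, pow_two, Complex.add_re, Complex.add_im, Complex.mul_re,
    Complex.mul_im, Complex.zero_re, Complex.zero_im]
  constructor <;> rintro ⟨h1, h2⟩ <;> constructor <;> linarith

theorem stmt18 (U : Set ℂ) (hU : IsOpen U) (φ : ℂ → ℂ)
    (hφ : ContDiffOn ℝ 2 φ U) (f g : ℂ → ℝ)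
    (hfg : ∀ z : ℂ, φ z = (f z : ℂ) + (g z : ℂ) * Complex.I) :
    (∀ z ∈ U, lap2C φ z = 0 ∧ lap2C (fun w => (φ w) ^ 2) z = 0) ↔
    (∀ z ∈ U, lap2R f z = 0 ∧ lap2R g z = 0 ∧
      (fderiv ℝ f z 1) ^ 2 + (fderiv ℝ f z Complex.I) ^ 2 =
        (fderiv ℝ g z 1) ^ 2 + (fderiv ℝ g z Complex.I) ^ 2 ∧
      (fderiv ℝ f z 1) * (fderiv ℝ g z 1) +
        (fderiv ℝ f z Complex.I) * (fderiv ℝ g z Complex.I) = 0) := by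
  have hf : f = fun w => Complex.reCLM (φ w) := by ext w; simp [hfg]
  have hg : g = fun w => Complex.imCLM (φ w) := by ext w; simp [hfg]
  refine forall₂_congr fun z hz => ?_
  have hh : ContDiffAt ℝ 2 φ z := hφ.contDiffAt (hU.mem_nhds hz)
  have hd := (hh.differentiableAt (by simp)).fderiv_clm_comp_apply (G := ℝ)
  rw [hf, hg, lap2R_clm_comp hh, lap2R_clm_comp hh, lap2C_sq hh]
  simp only [hd]
  simp only [Complex.reCLM_apply, Complex.imCLM_apply]
  rw [← Complex.sq_add_sq_eq_zero_iff, ← and_assoc,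
    show lap2C φ z = 0 ↔ (lap2C φ z).re = 0 ∧ (lap2C φ z).im = 0 from Complex.ext_iff]
  refine and_congr_right fun hre => ?_
  rw [show lap2C φ z = 0 from Complex.ext hre.1 hre.2]
  simp
end
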